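/- arXiv:2310.16740 — 2 statements merged into one kernel-verified Lean document; each statement's English description precedes it below -/
import Mathlib

section
/- For every fixed first-order formula Φ(x₁,…,x_n) over the vocabulary {+,×} of ternary addition and multiplication relations, there exists a fixed counter program C such that the tuple unary language L_Φ arithmetically reduces to the tuple unary language L_C; that is, there exist polynomials p₁,…,p_k : ℕ^{n+1} → ℕ such that for all N ∈ ℕ and a₁,…,a_n ≤ N, ⟨{0,…,N},+,×⟩ ⊨ Φ(a₁,…,a_n) if and only if C has a zero-terminating run from the initial counter valuation (p₁(N,a₁,…,a_n),…,p_k(N,a₁,…,a_n)). -/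
open FirstOrder

/-!
STATEMENT 0: For every fixed first-order formula `Φ(x₁,…,x_n)` over the
vocabulary `{+,×}` of ternary addition and multiplication relations, there is a
fixed counter program `C` such that `L_Φ` arithmetically reduces to `L_C`:
there are polynomials `p₁,…,p_k : ℕ^{n+1} → ℕ` such that for all `N ∈ ℕ` and
`a₁,…,a_n ≤ N`, `⟨{0,…,N},+,×⟩ ⊨ Φ(a₁,…,a_n)` iff `C` has a zero-terminating
run from the initial counter valuation `(p₁(N,a),…,p_k(N,a))`.
-/

/-- The two ternary arithmetical relation symbols. -/
inductive ArithRel : ℕ → Type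
  | add : ArithRel 3
  | mul : ArithRel 3

/-- The purely relational first-order vocabulary `{+, ×}`. -/
def arithLang : Language where
  Functions := fun _ => Empty
  Relations := ArithRel

/-- Interpretation of the relation symbols on the initial segment `{0,…,N}`:
`add(a,b,c)` iff `a + b = c`, and `mul(a,b,c)` iff `a · b = c`. -/
def segRel (N : ℕ) : ∀ {n : ℕ}, ArithRel n → (Fin n → Fin (N + 1)) → Prop
  | _, .add, v => ((v 0 : ℕ) + (v 1 : ℕ) = (v 2 : ℕ))
  | _, .mul, v => ((v 0 : ℕ) * (v 1 : ℕ) = (v 2 : ℕ))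

/-- The initial segment `{0,…,N}` of `ℕ` as a `{+,×}`-structure. -/
def segStructure (N : ℕ) : arithLang.Structure (Fin (N + 1)) where
  funMap := fun f _ => f.elim
  RelMap := segRel N

/-- `⟨{0,…,N}, +, ×⟩ ⊨ Φ(a)`. -/
def SegModels (N : ℕ) {α : Type} (Φ : arithLang.Formula α) (a : α → Fin (N + 1)) : Prop :=
  letI := segStructure N
  Φ.Realize a

/-- Instructions of a (line-based) counter program over `k` counters. -/
inductive Instr (k : ℕ) : Type
  | inc : Fin k → ℕ → Instr k       -- x += c
  | dec : Fin k → ℕ → Instr k       -- x -= c (blocking)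
  | goto : ℕ → ℕ → Instr k          -- goto L₁ or L₂
  | skip : Instr k
  | halt : Instr k

/-- A counter program is a finite sequence of lines (numbered from 1). -/
abbrev CounterProgram (k : ℕ) := List (Instr k)

/-- The instruction on line `L` (lines numbered from 1). -/
def lineAt {k : ℕ} (P : CounterProgram k) (L : ℕ) : Option (Instr k) := P[L - 1]?

/-- One step of a counter program between configurations `(L, f)`. -/
inductive CPStep {k : ℕ} (P : CounterProgram k) :
    (ℕ × (Fin k → ℕ)) → (ℕ × (Fin k → ℕ)) → Prop
  | inc {L : ℕ} {f : Fin k → ℕ} {x : Fin k} {c : ℕ}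
      (h : lineAt P L = some (.inc x c)) :
      CPStep P (L, f) (L + 1, Function.update f x (f x + c))
  | dec {L : ℕ} {f : Fin k → ℕ} {x : Fin k} {c : ℕ}
      (h : lineAt P L = some (.dec x c)) (hc : c ≤ f x) :
      CPStep P (L, f) (L + 1, Function.update f x (f x - c))
  | gotoL {L : ℕ} {f : Fin k → ℕ} {L₁ L₂ : ℕ}
      (h : lineAt P L = some (.goto L₁ L₂)) : CPStep P (L, f) (L₁, f)
  | gotoR {L : ℕ} {f : Fin k → ℕ} {L₁ L₂ : ℕ}
      (h : lineAt P L = some (.goto L₁ L₂)) : CPStep P (L, f) (L₂, f)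
  | skip {L : ℕ} {f : Fin k → ℕ}
      (h : lineAt P L = some .skip) : CPStep P (L, f) (L + 1, f)

/-- `C` has a zero-terminating run from the initial counter valuation `f`:
a run starting on line 1 that ends at the `halt` instruction with all counters
equal to zero. -/
def ZeroTerminating {k : ℕ} (P : CounterProgram k) (f : Fin k → ℕ) : Prop :=
  ∃ L : ℕ, lineAt P L = some .halt ∧
    Relation.ReflTransGen (CPStep P) (1, f) (L, fun _ => 0)


namespace FOCP

/-! ### Low-level structured programs -/

inductive LProg (κ : Type) : Type
  | inc : κ → LProg κ
  | dec : κ → LProg κ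
  | skip : LProg κ
  | seq : LProg κ → LProg κ → LProg κ
  | ch : LProg κ → LProg κ → LProg κ
  | star : LProg κ → LProg κ

inductive LSem {κ : Type} [DecidableEq κ] : LProg κ → (κ → ℕ) → (κ → ℕ) → Prop
  | inc {x : κ} {f : κ → ℕ} : LSem (.inc x) f (Function.update f x (f x + 1))
  | dec {x : κ} {f : κ → ℕ} (h : 0 < f x) : LSem (.dec x) f (Function.update f x (f x - 1))
  | skip {f : κ → ℕ} : LSem .skip f f
  | seq {p q : LProg κ} {f g h : κ → ℕ} : LSem p f g → LSem q g h → LSem (.seq p q) f h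
  | chl {p q : LProg κ} {f g : κ → ℕ} : LSem p f g → LSem (.ch p q) f g
  | chr {p q : LProg κ} {f g : κ → ℕ} : LSem q f g → LSem (.ch p q) f g
  | nil {p : LProg κ} {f : κ → ℕ} : LSem (.star p) f f
  | cons {p : LProg κ} {f g h : κ → ℕ} : LSem p f g → LSem (.star p) g h → LSem (.star p) f h

theorem LSem.star_inv {κ : Type} [DecidableEq κ] {p : LProg κ} (Inv : (κ → ℕ) → Prop)
    (hp : ∀ f g, Inv f → LSem p f g → Inv g) {f g : κ → ℕ}
    (h : LSem (.star p) f g) (hf : Inv f) : Inv g := by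
  generalize hq : LProg.star p = q at h
  induction h with
  | nil => exact hf
  | cons h1 h2 _ ih2 =>
    cases hq
    exact ih2 (hp _ _ hf h1) rfl
  | _ => cases hq

/-! ### Compilation to line-based programs -/

def LProg.len {κ : Type} : LProg κ → ℕ
  | .inc _ => 1
  | .dec _ => 1
  | .skip => 1
  | .seq p q => p.len + q.len
  | .ch p q => p.len + q.len + 2
  | .star p => p.len + 2

def comp {κ : Type} {k : ℕ} (e : κ ≃ Fin k) : ℕ → LProg κ → List (Instr k)
  | _, .inc x => [.inc (e x) 1]
  | _, .dec x => [.dec (e x) 1]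
  | _, .skip => [.skip]
  | L, .seq p q => comp e L p ++ comp e (L + p.len) q
  | L, .ch p q => .goto (L + 1) (L + p.len + 2) ::
      (comp e (L + 1) p ++ (.goto (L + p.len + q.len + 2) (L + p.len + q.len + 2) ::
        comp e (L + p.len + 2) q))
  | L, .star p => .goto (L + 1) (L + p.len + 2) :: (comp e (L + 1) p ++ [.goto L L])

theorem comp_length {κ : Type} {k : ℕ} (e : κ ≃ Fin k) (p : LProg κ) :
    ∀ L, (comp e L p).length = p.len := by
  induction p with
  | seq p q hp hq => intro L; simp [comp, LProg.len, hp, hq]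
  | ch p q hp hq => intro L; simp [comp, LProg.len, hp, hq]; omega
  | star p hp => intro L; simp [comp, LProg.len, hp]
  | _ => intro L; rfl

theorem comp_no_halt {κ : Type} {k : ℕ} (e : κ ≃ Fin k) (p : LProg κ) :
    ∀ L, Instr.halt ∉ comp e L p := by
  induction p with
  | seq p q hp hq => intro L; simp [comp, hp, hq]
  | ch p q hp hq => intro L; simp [comp, hp, hq]
  | star p hp => intro L; simp [comp, hp]
  | _ => intro L; simp [comp]

/-- The block `l` sits at line `L` of `P`. -/
def At {k : ℕ} (P : CounterProgram k) (L : ℕ) (l : List (Instr k)) : Prop :=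
  ∀ i (h : i < l.length), lineAt P (L + i) = some l[i]

theorem At.cons {k : ℕ} {P : CounterProgram k} {L : ℕ} {a : Instr k} {l : List (Instr k)}
    (h : At P L (a :: l)) : lineAt P L = some a ∧ At P (L + 1) l := by
  refine ⟨h 0 (by simp), fun i hi => ?_⟩
  have := h (i + 1) (by simpa using hi)
  rw [show L + 1 + i = L + (i + 1) by omega, this]
  simp

theorem At.append {k : ℕ} {P : CounterProgram k} {L : ℕ} {l l' : List (Instr k)}
    (h : At P L (l ++ l')) : At P L l ∧ At P (L + l.length) l' := by
  refine ⟨fun i hi => ?_, fun i hi => ?_⟩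
  · rw [h i (by simp; omega)]
    simp [List.getElem_append_left hi]
  · rw [show L + l.length + i = L + (l.length + i) by omega, h (l.length + i) (by simpa using hi)]
    simp

inductive RunN {k : ℕ} (P : CounterProgram k) :
    ℕ → (ℕ × (Fin k → ℕ)) → (ℕ × (Fin k → ℕ)) → Prop
  | nil {c : ℕ × (Fin k → ℕ)} : RunN P 0 c c
  | cons {n : ℕ} {c d e : ℕ × (Fin k → ℕ)} : CPStep P c d → RunN P n d e → RunN P (n + 1) c e

theorem runN_of_rtg {k : ℕ} {P : CounterProgram k} {c d : ℕ × (Fin k → ℕ)}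
    (h : Relation.ReflTransGen (CPStep P) c d) : ∃ n, RunN P n c d := by
  induction h using Relation.ReflTransGen.head_induction_on with
  | refl => exact ⟨0, .nil⟩
  | head h1 _ ih => obtain ⟨n, hn⟩ := ih; exact ⟨n + 1, .cons h1 hn⟩

theorem comp_complete {κ : Type} [DecidableEq κ] {k : ℕ} (e : κ ≃ Fin k) {P : CounterProgram k}
    {p : LProg κ} {f g : κ → ℕ} (h : LSem p f g) :
    ∀ L, At P L (comp e L p) →
      Relation.ReflTransGen (CPStep P) (L, f ∘ e.symm) (L + p.len, g ∘ e.symm) := by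
  induction h with
  | @inc x f =>
    intro L hA
    have h1 := CPStep.inc (f := f ∘ e.symm) hA.cons.1
    refine .single ?_
    rw [Function.update_comp_equiv]
    simpa [LProg.len] using h1
  | @dec x f hx =>
    intro L hA
    have h1 := CPStep.dec (f := f ∘ e.symm) hA.cons.1 (by simpa using Nat.succ_le_of_lt hx)
    refine .single ?_
    rw [Function.update_comp_equiv]
    simpa [LProg.len] using h1
  | skip =>
    intro L hA
    exact .single (CPStep.skip hA.cons.1)
  | @seq p q f g h _ _ ih1 ih2 =>
    intro L hA
    have hA' := At.append hA
    rw [comp_length] at hA'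
    have := (ih1 _ hA'.1).trans (ih2 _ hA'.2)
    rwa [show L + p.len + q.len = L + (p.len + q.len) by omega] at this
  | @chl p q f g _ ih =>
    intro L hA
    obtain ⟨h0, hA⟩ := At.cons hA
    obtain ⟨hp, hA⟩ := At.append hA
    obtain ⟨h1, hq⟩ := At.cons hA
    rw [comp_length] at h1 hq
    refine (Relation.ReflTransGen.single (CPStep.gotoL h0)).trans ((ih _ hp).trans (.single ?_))
    have := CPStep.gotoL (f := g ∘ e.symm) h1
    rwa [show L + p.len + q.len + 2 = L + (p.len + q.len + 2) by omega] at this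
  | @chr p q f g _ ih =>
    intro L hA
    obtain ⟨h0, hA⟩ := At.cons hA
    obtain ⟨hp, hA⟩ := At.append hA
    obtain ⟨h1, hq⟩ := At.cons hA
    rw [comp_length] at h1 hq
    refine (Relation.ReflTransGen.single (CPStep.gotoR h0)).trans ?_
    rw [show L + 1 + p.len + 1 = L + p.len + 2 by omega] at hq
    have := ih _ hq
    rwa [show L + p.len + 2 + q.len = L + (p.len + q.len + 2) by omega] at this
  | @nil p f =>
    intro L hA
    exact .single (CPStep.gotoR (At.cons hA).1)
  | @cons p f g h _ _ ih1 ih2 =>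
    intro L hA
    have hA0 := hA
    obtain ⟨h0, hA⟩ := At.cons hA
    obtain ⟨hp, hA⟩ := At.append hA
    obtain ⟨h1, -⟩ := At.cons hA
    rw [comp_length] at h1
    exact (Relation.ReflTransGen.single (CPStep.gotoL h0)).trans
      ((ih1 _ hp).trans ((Relation.ReflTransGen.single (CPStep.gotoL h1)).trans (ih2 _ hA0)))

theorem step_inv {k : ℕ} {P : CounterProgram k} {L : ℕ} {f : Fin k → ℕ}
    {c : ℕ × (Fin k → ℕ)} (h : CPStep P (L, f) c) {i : Instr k} (hi : lineAt P L = some i) :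
    match i with
    | .inc x n => c = (L + 1, Function.update f x (f x + n))
    | .dec x n => n ≤ f x ∧ c = (L + 1, Function.update f x (f x - n))
    | .goto a b => c = (a, f) ∨ c = (b, f)
    | .skip => c = (L + 1, f)
    | .halt => False := by
  cases h with
  | inc h => rw [h] at hi; cases hi; rfl
  | dec h hc => rw [h] at hi; cases hi; exact ⟨hc, rfl⟩
  | gotoL h => rw [h] at hi; cases hi; exact .inl rfl
  | gotoR h => rw [h] at hi; cases hi; exact .inr rfl
  | skip h => rw [h] at hi; cases hi; rfl

theorem run_first {k : ℕ} {P : CounterProgram k} {n L E : ℕ} {f h : Fin k → ℕ}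
    (hr : RunN P n (L, f) (E, h)) (hne : E ≠ L) :
    ∃ m c, n = m + 1 ∧ CPStep P (L, f) c ∧ RunN P m c (E, h) := by
  cases hr with
  | nil => exact absurd rfl hne
  | cons h1 h2 => exact ⟨_, _, rfl, h1, h2⟩

theorem comp_sound {κ : Type} [DecidableEq κ] {k : ℕ} (e : κ ≃ Fin k) {P : CounterProgram k}
    {E : ℕ} {h : Fin k → ℕ} (p : LProg κ) :
    ∀ L, At P L (comp e L p) → (E < L ∨ L + p.len ≤ E) → ∀ n (f : κ → ℕ),
      RunN P n (L, f ∘ e.symm) (E, h) →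
      ∃ m g, m ≤ n ∧ LSem p f g ∧ RunN P m (L + p.len, g ∘ e.symm) (E, h) := by
  induction p with
  | inc x =>
    intro L hA hE n f hr
    simp only [LProg.len] at *
    obtain ⟨m, c, rfl, h1, h2⟩ := run_first hr (by omega)
    have := step_inv h1 (At.cons hA).1
    simp only at this
    subst this
    refine ⟨m, _, by omega, .inc, ?_⟩
    rw [Function.update_comp_equiv]
    simpa using h2
  | dec x =>
    intro L hA hE n f hr
    simp only [LProg.len] at *
    obtain ⟨m, c, rfl, h1, h2⟩ := run_first hr (by omega)
    have := step_inv h1 (At.cons hA).1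
    simp only at this
    obtain ⟨h3, rfl⟩ := this
    refine ⟨m, _, by omega, .dec (by simpa [Nat.succ_le_iff] using h3), ?_⟩
    rw [Function.update_comp_equiv]
    simpa using h2
  | skip =>
    intro L hA hE n f hr
    simp only [LProg.len] at *
    obtain ⟨m, c, rfl, h1, h2⟩ := run_first hr (by omega)
    have := step_inv h1 (At.cons hA).1
    simp only at this
    subst this
    exact ⟨m, _, by omega, .skip, h2⟩
  | seq p q ihp ihq =>
    intro L hA hE n f hr
    simp only [LProg.len] at *
    have hA' := At.append hA
    rw [comp_length] at hA'
    obtain ⟨m, g, hm, hs, hr⟩ := ihp L hA'.1 (by omega) n f hr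
    obtain ⟨m', g', hm', hs', hr⟩ := ihq _ hA'.2 (by omega) m g hr
    refine ⟨m', g', by omega, .seq hs hs', ?_⟩
    rwa [show L + p.len + q.len = L + (p.len + q.len) by omega] at hr
  | ch p q ihp ihq =>
    intro L hA hE n f hr
    simp only [LProg.len] at *
    obtain ⟨h0, hA⟩ := At.cons hA
    obtain ⟨hp, hA⟩ := At.append hA
    obtain ⟨h1, hq⟩ := At.cons hA
    rw [comp_length] at h1 hq
    rw [show L + 1 + p.len + 1 = L + p.len + 2 by omega] at hq
    obtain ⟨m, c, rfl, hs, hr⟩ := run_first hr (by omega)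
    rcases step_inv hs h0 with rfl | rfl
    · obtain ⟨m', g, hm, hs', hr⟩ := ihp _ hp (by omega) m f hr
      obtain ⟨m, c, rfl, hs, hr⟩ := run_first hr (by omega)
      have : c = (L + p.len + q.len + 2, g ∘ e.symm) := by
        rcases step_inv hs h1 with h | h <;> exact h
      subst this
      refine ⟨m, g, by omega, .chl hs', ?_⟩
      rwa [show L + p.len + q.len + 2 = L + (p.len + q.len + 2) by omega] at hr
    · obtain ⟨m', g, hm, hs', hr⟩ := ihq _ hq (by omega) m f hr
      refine ⟨m', g, by omega, .chr hs', ?_⟩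
      rwa [show L + p.len + 2 + q.len = L + (p.len + q.len + 2) by omega] at hr
  | star p ihp =>
    intro L hA hE n
    simp only [LProg.len] at *
    obtain ⟨h0, hA⟩ := At.cons hA
    obtain ⟨hp, hA⟩ := At.append hA
    obtain ⟨h1, -⟩ := At.cons hA
    rw [comp_length] at h1
    induction n using Nat.strong_induction_on with
    | _ n ih =>
      intro f hr
      obtain ⟨m, c, rfl, hs, hr⟩ := run_first hr (by omega)
      rcases step_inv hs h0 with rfl | rfl
      · obtain ⟨m', g, hm, hs', hr⟩ := ihp _ hp (by omega) m f hr
        obtain ⟨m'', c, rfl, hs, hr⟩ := run_first hr (by omega)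
        have : c = (L, g ∘ e.symm) := by
          rcases step_inv hs h1 with h | h <;> exact h
        subst this
        obtain ⟨m3, g', hm3, hs3, hr3⟩ := ih m'' (by omega) g hr
        exact ⟨m3, g', by omega, .cons hs' hs3, hr3⟩
      · exact ⟨m, f, by omega, .nil, hr⟩

theorem compile_correct {κ : Type} [DecidableEq κ] {k : ℕ} (e : κ ≃ Fin k) (p : LProg κ)
    (f : κ → ℕ) :
    ZeroTerminating (comp e 1 p ++ [.halt]) (f ∘ e.symm) ↔ LSem p f (fun _ => 0) := by
  set P := comp e 1 p ++ [Instr.halt] with hP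
  have hall : At P 1 (comp e 1 p ++ [Instr.halt]) := by
    intro i hi
    simp [lineAt, hP]
  obtain ⟨hA, hH⟩ := At.append hall
  have hH := (At.cons hH).1
  rw [comp_length] at hH
  constructor
  · rintro ⟨E, hE, hr⟩
    obtain ⟨n, hn⟩ := runN_of_rtg hr
    have hE' : E < 1 ∨ 1 + p.len ≤ E := by
      by_contra hcon
      push Not at hcon
      have h1 := hA (E - 1) (by rw [comp_length]; omega)
      rw [show 1 + (E - 1) = E by omega, hE] at h1
      have h2 : Instr.halt = (comp e 1 p)[E - 1]'(by rw [comp_length]; omega) := by simpa using h1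
      exact comp_no_halt e p 1 (by rw [h2]; exact List.getElem_mem _)
    obtain ⟨m, g, -, hs, hr⟩ := comp_sound e p 1 hA hE' n f hn
    generalize hc : (1 + p.len, g ∘ e.symm) = c at hr
    generalize hd : ((E, fun _ => 0) : ℕ × (Fin k → ℕ)) = d at hr
    cases hr with
    | nil =>
      rw [← hd] at hc
      have h3 : g ∘ e.symm = fun _ => 0 := (Prod.ext_iff.1 hc).2
      have : g = fun _ => 0 := by
        funext x
        have := congrFun h3 (e x)
        simpa using this
      rwa [this] at hs
    | cons h1 _ =>
      subst hc
      exact (step_inv h1 hH).elim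
  · intro hs
    refine ⟨1 + p.len, hH, ?_⟩
    exact comp_complete e hs 1 hA

/-! ### Bounded counter programs with zero tests -/

inductive Prog (V : Type) : Type
  | inc : V → Prog V
  | dec : V → Prog V
  | zt : V → Prog V
  | mt : V → Prog V
  | seq : Prog V → Prog V → Prog V
  | ch : Prog V → Prog V → Prog V
  | star : Prog V → Prog V

/-- Semantics with counters in `{0,…,B}`; the natural number index counts the tests. -/
inductive Sem {V : Type} [DecidableEq V] (B : ℕ) : Prog V → (V → ℕ) → ℕ → (V → ℕ) → Prop
  | inc {x : V} {f : V → ℕ} (h : f x < B) : Sem B (.inc x) f 0 (Function.update f x (f x + 1))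
  | dec {x : V} {f : V → ℕ} (h : 0 < f x) : Sem B (.dec x) f 0 (Function.update f x (f x - 1))
  | zt {x : V} {f : V → ℕ} (h : f x = 0) : Sem B (.zt x) f 1 f
  | mt {x : V} {f : V → ℕ} (h : f x = B) : Sem B (.mt x) f 1 f
  | seq {p q : Prog V} {f g h : V → ℕ} {t t' : ℕ} :
      Sem B p f t g → Sem B q g t' h → Sem B (.seq p q) f (t + t') h
  | chl {p q : Prog V} {f g : V → ℕ} {t : ℕ} : Sem B p f t g → Sem B (.ch p q) f t g
  | chr {p q : Prog V} {f g : V → ℕ} {t : ℕ} : Sem B q f t g → Sem B (.ch p q) f t g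
  | nil {p : Prog V} {f : V → ℕ} : Sem B (.star p) f 0 f
  | cons {p : Prog V} {f g h : V → ℕ} {t t' : ℕ} :
      Sem B p f t g → Sem B (.star p) g t' h → Sem B (.star p) f (t + t') h

/-- Counters of the low-level program. -/
inductive K (V : Type) (n : ℕ) : Type
  | cnt : V → Bool → K V n
  | c : K V n
  | d : K V n
  | inp : Fin n → K V n
  deriving DecidableEq, Fintype

section Translation

variable {V : Type} [DecidableEq V] {n : ℕ}

def move (x : V) (b : Bool) : LProg (K V n) := .seq (.dec (.cnt x (!b))) (.inc (.cnt x b))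

def loopT (x : V) (b : Bool) : LProg (K V n) := .star (.seq (.dec .d) (move x b))

def test (x : V) (b : Bool) : LProg (K V n) :=
  .seq (.dec .c) (.seq (loopT x b) (loopT x (!b)))

def tr : Prog V → LProg (K V n)
  | .inc x => move x true
  | .dec x => move x false
  | .zt x => test x true
  | .mt x => test x false
  | .seq p q => .seq (tr p) (tr q)
  | .ch p q => .ch (tr p) (tr q)
  | .star p => .star (tr p)

def Inv (B : ℕ) (s : K V n → ℕ) : Prop := ∀ x b, s (.cnt x b) + s (.cnt x (!b)) = B

def val (s : K V n → ℕ) : V → ℕ := fun x => s (.cnt x true)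

theorem Inv.of {B : ℕ} {s : K V n → ℕ} (h : ∀ x, s (.cnt x true) + s (.cnt x false) = B) :
    Inv B s := by
  intro x b
  cases b
  · simpa [add_comm] using h x
  · exact h x

theorem move_sound {x : V} {b : Bool} {s s' : K V n → ℕ} (h : LSem (move x b) s s') :
    0 < s (.cnt x (!b)) ∧ s' (.cnt x (!b)) + 1 = s (.cnt x (!b)) ∧
    s' (.cnt x b) = s (.cnt x b) + 1 ∧
    ∀ z, z ≠ .cnt x b → z ≠ .cnt x (!b) → s' z = s z := by
  cases h with
  | seq h1 h2 =>
    cases h1 with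
    | dec h =>
      cases h2 with
      | inc =>
        refine ⟨h, ?_, ?_, ?_⟩
        · simp [Function.update_apply]; omega
        · simp [Function.update_apply]
        · intro z h1 h2
          simp [Function.update_apply, h1, h2]

theorem move_complete {x : V} {b : Bool} {s : K V n → ℕ} (h : 0 < s (.cnt x (!b))) :
    ∃ s', LSem (move x b) s s' :=
  ⟨_, .seq (.dec h) .inc⟩

theorem Inv.move {B : ℕ} {x : V} {b : Bool} {s s' : K V n → ℕ} (hI : Inv B s)
    (h : LSem (move x b) s s') : Inv B s' := by
  obtain ⟨h1, h2, h3, h4⟩ := move_sound h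
  intro y b'
  by_cases hy : y = x
  · subst hy
    have := hI y b
    cases b <;> cases b' <;> simp at * <;> omega
  · rw [h4 _ (by simp [hy]) (by simp [hy]), h4 _ (by simp [hy]) (by simp [hy])]
    exact hI y b'

theorem loop_sound {B : ℕ} {x : V} {b : Bool} {s s' : K V n → ℕ} (h : LSem (loopT x b) s s')
    (hI : Inv B s) :
    Inv B s' ∧ s' .d + s' (.cnt x b) = s .d + s (.cnt x b) ∧ s' .d ≤ s .d ∧
    ∀ z, z ≠ .d → z ≠ .cnt x b → z ≠ .cnt x (!b) → s' z = s z := by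
  refine LSem.star_inv (fun g => Inv B g ∧ g .d + g (.cnt x b) = s .d + s (.cnt x b) ∧
    g .d ≤ s .d ∧ ∀ z, z ≠ .d → z ≠ .cnt x b → z ≠ .cnt x (!b) → g z = s z) ?_ h
    ⟨hI, rfl, le_rfl, fun _ _ _ _ => rfl⟩
  rintro f g ⟨i1, i2, i3, i4⟩ hs
  cases hs with
  | seq h1 h2 =>
    cases h1 with
    | dec hd =>
      have hI' : Inv B (Function.update f .d (f .d - 1)) := by
        intro y b'
        simpa [Function.update_apply] using i1 y b'
      obtain ⟨m1, m2, m3, m4⟩ := move_sound h2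
      have m5 := m4 .d (by simp) (by simp)
      simp [Function.update_apply] at m1 m2 m3 m5
      refine ⟨hI'.move h2, by omega, by omega, fun z z1 z2 z3 => ?_⟩
      rw [m4 z z2 z3, Function.update_apply, if_neg z1, i4 z z1 z2 z3]

theorem loop_complete {x : V} {b : Bool} : ∀ (j : ℕ) (s : K V n → ℕ),
    s (.cnt x (!b)) = j → j ≤ s .d →
    ∃ s', LSem (loopT x b) s s' ∧ s' (.cnt x (!b)) = 0 ∧ s' .d + j = s .d ∧
      s' (.cnt x b) = s (.cnt x b) + j ∧
      ∀ z, z ≠ .d → z ≠ .cnt x b → z ≠ .cnt x (!b) → s' z = s z := by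
  intro j
  induction j with
  | zero => intro s h _; exact ⟨s, .nil, h, rfl, rfl, fun _ _ _ _ => rfl⟩
  | succ j ih =>
    intro s h hd
    obtain ⟨s1, hs1⟩ := move_complete (x := x) (b := b) (s := Function.update s .d (s .d - 1))
      (by simp [Function.update_apply]; omega)
    obtain ⟨m1, m2, m3, m4⟩ := move_sound hs1
    have m5 := m4 .d (by simp) (by simp)
    simp [Function.update_apply] at m1 m2 m3 m5
    obtain ⟨s', h1, h2, h3, h4, h5⟩ := ih s1 (by omega) (by omega)
    refine ⟨s', .cons (.seq (.dec (by omega)) hs1) h1, h2, by omega, by omega,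
      fun z z1 z2 z3 => ?_⟩
    rw [h5 z z1 z2 z3, m4 z z2 z3, Function.update_apply, if_neg z1]

theorem test_sound {B : ℕ} {x : V} {b : Bool} {s s' : K V n → ℕ} (h : LSem (test x b) s s')
    (hI : Inv B s) :
    Inv B s' ∧ (∀ i, s' (.inp i) = s (.inp i)) ∧ s' .c + 1 = s .c ∧
    ∃ δ, s' .d + δ = s .d ∧ δ ≤ 2 * B ∧
      (δ = 2 * B → s (.cnt x b) = 0 ∧ val s' = val s) := by
  cases h with
  | seq h1 h2 =>
    cases h1 with
    | dec hc =>
      cases h2 with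
      | @seq _ _ _ s1 _ h1 h2 =>
        have hI0 : Inv B (Function.update s .c (s .c - 1)) := by
          intro y b'
          simpa [Function.update_apply] using hI y b'
        obtain ⟨a1, a2, a3, a4⟩ := loop_sound h1 hI0
        obtain ⟨b1, b2, b3, b4⟩ := loop_sound h2 a1
        simp only [Bool.not_not] at b4
        have ac := a4 .c (by simp) (by simp) (by simp)
        have bc := b4 .c (by simp) (by simp) (by simp)
        simp [Function.update_apply] at a2 a3 ac
        have e1 := hI x b
        have e2 := a1 x b
        have e3 := b1 x b
        refine ⟨b1, fun i => ?_, by omega, s .d - s' .d, by omega, by omega, fun hδ => ?_⟩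
        · rw [b4 _ (by simp) (by simp) (by simp), a4 _ (by simp) (by simp) (by simp)]
          simp [Function.update_apply]
        · refine ⟨by omega, funext fun y => ?_⟩
          unfold val
          by_cases hy : y = x
          · subst hy
            cases b
            · simp at *; omega
            · simp at *; omega
          · rw [b4 _ (by simp) (by simp [hy]) (by simp [hy]),
              a4 _ (by simp) (by simp [hy]) (by simp [hy])]
            simp [Function.update_apply]

theorem test_complete {B : ℕ} {x : V} {b : Bool} {s : K V n → ℕ} (hI : Inv B s)
    (hx : s (.cnt x b) = 0) (hc : 1 ≤ s .c) (hd : 2 * B ≤ s .d) :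
    ∃ s', LSem (test x b) s s' ∧ s' .c + 1 = s .c ∧ s' .d + 2 * B = s .d := by
  have e0 := hI x b
  obtain ⟨s1, h1, h2, h3, h4, h5⟩ := loop_complete (x := x) (b := b) B
    (Function.update s .c (s .c - 1)) (by simp [Function.update_apply]; omega)
    (by simp [Function.update_apply]; omega)
  simp [Function.update_apply] at h3 h4
  obtain ⟨s2, g1, g2, g3, g4, g5⟩ := loop_complete (x := x) (b := !b) B s1
    (by simp; omega) (by omega)
  refine ⟨s2, .seq (.dec (by omega)) (.seq h1 g1), ?_, by omega⟩
  rw [g5 _ (by simp) (by simp) (by simp), h5 _ (by simp) (by simp) (by simp)]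
  simp [Function.update_apply]; omega

theorem tr_sound {B : ℕ} (p : Prog V) : ∀ (s s' : K V n → ℕ), LSem (tr p) s s' → Inv B s →
    Inv B s' ∧ (∀ i, s' (.inp i) = s (.inp i)) ∧ ∃ t δ, s' .c + t = s .c ∧ s' .d + δ = s .d ∧
      δ ≤ 2 * B * t ∧ (δ = 2 * B * t → Sem B p (val s) t (val s')) := by
  induction p with
  | inc x =>
    intro s s' h hI
    have hm := hI.move h
    obtain ⟨h1, h2, h3, h4⟩ := move_sound h
    have e := hI x true
    refine ⟨hm, fun i => h4 _ (by simp) (by simp), 0, 0, h4 _ (by simp) (by simp),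
      h4 _ (by simp) (by simp), by simp, fun _ => ?_⟩
    have : val s' = Function.update (val s) x (val s x + 1) := by
      funext y
      by_cases hy : y = x
      · subst hy; simp [val, h3]
      · simp [val, Function.update_apply, hy, h4 (.cnt y true) (by simp [hy]) (by simp)]
    rw [this]
    exact .inc (by simp [val] at *; omega)
  | dec x =>
    intro s s' h hI
    have hm := hI.move h
    obtain ⟨h1, h2, h3, h4⟩ := move_sound h
    refine ⟨hm, fun i => h4 _ (by simp) (by simp), 0, 0, h4 _ (by simp) (by simp),
      h4 _ (by simp) (by simp), by simp, fun _ => ?_⟩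
    simp at h1 h2
    have : val s' = Function.update (val s) x (val s x - 1) := by
      funext y
      by_cases hy : y = x
      · subst hy; simp [val]; omega
      · simp [val, Function.update_apply, hy, h4 (.cnt y true) (by simp) (by simp [hy])]
    rw [this]
    exact .dec h1
  | zt x =>
    intro s s' h hI
    obtain ⟨h1, h2, h3, δ, h4, h5, h6⟩ := test_sound h hI
    refine ⟨h1, h2, 1, δ, h3, h4, by omega, fun hδ => ?_⟩
    obtain ⟨h7, h8⟩ := h6 (by omega)
    rw [h8]
    exact .zt h7
  | mt x =>
    intro s s' h hI
    obtain ⟨h1, h2, h3, δ, h4, h5, h6⟩ := test_sound h hI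
    refine ⟨h1, h2, 1, δ, h3, h4, by omega, fun hδ => ?_⟩
    obtain ⟨h7, h8⟩ := h6 (by omega)
    rw [h8]
    have := hI x true
    exact .mt (by simp [val] at *; omega)
  | seq p q ihp ihq =>
    intro s s' h hI
    cases h with
    | seq h1 h2 =>
      obtain ⟨a1, a2, t, δ, a3, a4, a5, a6⟩ := ihp _ _ h1 hI
      obtain ⟨b1, b2, t', δ', b3, b4, b5, b6⟩ := ihq _ _ h2 a1
      have hm : 2 * B * (t + t') = 2 * B * t + 2 * B * t' := by ring
      exact ⟨b1, fun i => (b2 i).trans (a2 i), t + t', δ + δ', by omega, by omega, by omega,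
        fun h => .seq (a6 (by omega)) (b6 (by omega))⟩
  | ch p q ihp ihq =>
    intro s s' h hI
    cases h with
    | chl h =>
      obtain ⟨a1, a2, t, δ, a3, a4, a5, a6⟩ := ihp _ _ h hI
      exact ⟨a1, a2, t, δ, a3, a4, a5, fun h => .chl (a6 h)⟩
    | chr h =>
      obtain ⟨a1, a2, t, δ, a3, a4, a5, a6⟩ := ihq _ _ h hI
      exact ⟨a1, a2, t, δ, a3, a4, a5, fun h => .chr (a6 h)⟩
  | star p ih =>
    intro s s' h
    generalize hq : (tr (Prog.star p) : LProg (K V n)) = q at h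
    induction h with
    | nil => exact fun hI => ⟨hI, fun _ => rfl, 0, 0, rfl, rfl, by simp, fun _ => .nil⟩
    | cons h1 h2 _ ih2 =>
      intro hI
      cases hq
      obtain ⟨a1, a2, t, δ, a3, a4, a5, a6⟩ := ih _ _ h1 hI
      obtain ⟨b1, b2, t', δ', b3, b4, b5, b6⟩ := ih2 rfl a1
      have hm : 2 * B * (t + t') = 2 * B * t + 2 * B * t' := by ring
      exact ⟨b1, fun i => (b2 i).trans (a2 i), t + t', δ + δ', by omega, by omega, by omega,
        fun h => .cons (a6 (by omega)) (b6 (by omega))⟩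
    | _ => simp [tr] at hq

theorem tr_complete {B : ℕ} {p : Prog V} {f g : V → ℕ} {t : ℕ} (h : Sem B p f t g) :
    ∀ s : K V n → ℕ, Inv B s → val s = f → t ≤ s .c → 2 * B * t ≤ s .d →
    ∃ s', LSem (tr p) s s' ∧ val s' = g ∧ s' .c + t = s .c ∧ s' .d + 2 * B * t = s .d := by
  induction h with
  | @inc x f h =>
    rintro s hI rfl - -
    have e := hI x true
    simp only [val] at h
    obtain ⟨s', hs⟩ := move_complete (x := x) (b := true) (s := s) (by omega)
    obtain ⟨h1, h2, h3, h4⟩ := move_sound hs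
    refine ⟨s', hs, ?_, h4 _ (by simp) (by simp), h4 _ (by simp) (by simp)⟩
    funext y
    by_cases hy : y = x
    · subst hy; simp [val, h3]
    · simp [val, Function.update_apply, hy, h4 (.cnt y true) (by simp [hy]) (by simp)]
  | @dec x f h =>
    rintro s hI rfl - -
    simp only [val] at h
    obtain ⟨s', hs⟩ := move_complete (x := x) (b := false) (s := s) h
    obtain ⟨h1, h2, h3, h4⟩ := move_sound hs
    refine ⟨s', hs, ?_, h4 _ (by simp) (by simp), h4 _ (by simp) (by simp)⟩
    simp at h2
    funext y
    by_cases hy : y = x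
    · subst hy; simp [val]; omega
    · simp [val, Function.update_apply, hy, h4 (.cnt y true) (by simp) (by simp [hy])]
  | @zt x f h =>
    rintro s hI rfl hc hd
    obtain ⟨s', h1, h2, h3⟩ := test_complete (x := x) (b := true) hI h hc (by omega)
    obtain ⟨_, _, _, δ, h4, h5, h6⟩ := test_sound h1 hI
    exact ⟨s', h1, (h6 (by omega)).2, h2, by omega⟩
  | @mt x f h =>
    rintro s hI rfl hc hd
    have := hI x true
    obtain ⟨s', h1, h2, h3⟩ := test_complete (x := x) (b := false) hI
      (by simp [val] at *; omega) hc (by omega)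
    obtain ⟨_, _, _, δ, h4, h5, h6⟩ := test_sound h1 hI
    exact ⟨s', h1, (h6 (by omega)).2, h2, by omega⟩
  | @seq p q f g h t t' _ _ ih1 ih2 =>
    rintro s hI rfl hc hd
    have hm : 2 * B * (t + t') = 2 * B * t + 2 * B * t' := by ring
    obtain ⟨s1, a1, a2, a3, a4⟩ := ih1 s hI rfl (by omega) (by omega)
    obtain ⟨s2, b1, b2, b3, b4⟩ := ih2 s1 (tr_sound _ _ _ a1 hI).1 a2 (by omega) (by omega)
    exact ⟨s2, .seq a1 b1, b2, by omega, by omega⟩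
  | chl _ ih =>
    rintro s hI rfl hc hd
    obtain ⟨s1, a1, a2⟩ := ih s hI rfl hc hd
    exact ⟨s1, .chl a1, a2⟩
  | chr _ ih =>
    rintro s hI rfl hc hd
    obtain ⟨s1, a1, a2⟩ := ih s hI rfl hc hd
    exact ⟨s1, .chr a1, a2⟩
  | nil =>
    rintro s hI rfl hc hd
    exact ⟨s, .nil, rfl, rfl, rfl⟩
  | @cons p f g h t t' _ _ ih1 ih2 =>
    rintro s hI rfl hc hd
    have hm : 2 * B * (t + t') = 2 * B * t + 2 * B * t' := by ring
    obtain ⟨s1, a1, a2, a3, a4⟩ := ih1 s hI rfl (by omega) (by omega)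
    obtain ⟨s2, b1, b2, b3, b4⟩ := ih2 s1 (tr_sound _ _ _ a1 hI).1 a2 (by omega) (by omega)
    exact ⟨s2, .cons a1 b1, b2, by omega, by omega⟩

end Translation

section Full

variable {V : Type} [DecidableEq V] {n : ℕ}

def anyP {κ : Type} : List (LProg κ) → LProg κ
  | [] => .skip
  | p :: l => .ch p (anyP l)

theorem anyP_sound {κ : Type} [DecidableEq κ] {f g : κ → ℕ} : ∀ l : List (LProg κ),
    LSem (anyP l) f g → g = f ∨ ∃ p ∈ l, LSem p f g
  | [], h => by cases h; exact .inl rfl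
  | p :: l, h => by
    cases h with
    | chl h => exact .inr ⟨p, by simp, h⟩
    | chr h =>
      rcases anyP_sound l h with h | ⟨q, hq, h⟩
      · exact .inl h
      · exact .inr ⟨q, by simp [hq], h⟩

theorem anyP_complete {κ : Type} [DecidableEq κ] {f g : κ → ℕ} : ∀ (l : List (LProg κ)),
    ∀ p ∈ l, LSem p f g → LSem (anyP l) f g
  | [], p, hp, _ => by simp at hp
  | q :: l, p, hp, h => by
    rcases List.mem_cons.1 hp with rfl | hp
    · exact .chl h
    · exact .chr (anyP_complete l p hp h)

def initStep (iv : Fin n → V) (i : Fin n) : LProg (K V n) :=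
  .seq (.dec (.inp i)) (move (iv i) true)

def initP (iv : Fin n → V) : LProg (K V n) :=
  .star (anyP ((List.finRange n).map (initStep iv)))

noncomputable def cleanP [Fintype V] : LProg (K V n) :=
  .star (anyP ((Finset.univ : Finset (V × Bool)).toList.map fun y => .dec (.cnt y.1 y.2)))

noncomputable def full [Fintype V] (iv : Fin n → V) (p : Prog V) : LProg (K V n) :=
  .seq (initP iv) (.seq (tr p) cleanP)

def start (B C : ℕ) (a : Fin n → ℕ) : K V n → ℕ
  | .cnt _ true => 0
  | .cnt _ false => B
  | .c => C
  | .d => 2 * B * C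
  | .inp i => a i

structure J (iv : Fin n → V) (B C : ℕ) (a : Fin n → ℕ) (s : K V n → ℕ) : Prop where
  inv : Inv B s
  hc : s .c = C
  hd : s .d = 2 * B * C
  hin : ∀ i, s (.inp i) + s (.cnt (iv i) true) = a i
  h0 : ∀ x, (∀ i, x ≠ iv i) → s (.cnt x true) = 0

theorem J.step {iv : Fin n → V} (hiv : Function.Injective iv) {B C : ℕ} {a : Fin n → ℕ}
    {s s' : K V n → ℕ} (hJ : J iv B C a s) {i : Fin n} (h : LSem (initStep iv i) s s') :
    J iv B C a s' ∧ s' (.inp i) + 1 = s (.inp i) ∧ ∀ j, j ≠ i → s' (.inp j) = s (.inp j) := by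
  cases h with
  | seq h1 h2 =>
    cases h1 with
    | dec hp =>
      have hI : Inv B (Function.update s (.inp i) (s (.inp i) - 1)) := by
        intro y b'
        simpa using hJ.inv y b'
      obtain ⟨m1, m2, m3, m4⟩ := move_sound h2
      have m5 : ∀ j, s' (.inp j) = _ := fun j => m4 (.inp j) (by simp) (by simp)
      have m6 := m5 i
      simp at m6 m3
      have m7 : ∀ j, j ≠ i → s' (.inp j) = s (.inp j) := by
        intro j hj
        rw [m5 j]; simp [hj]
      refine ⟨⟨hI.move h2, ?_, ?_, ?_, ?_⟩, by omega, m7⟩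
      · rw [m4 _ (by simp) (by simp)]; simp [hJ.hc]
      · rw [m4 _ (by simp) (by simp)]; simp [hJ.hd]
      · intro j
        have := hJ.hin j
        by_cases hj : j = i
        · subst hj; omega
        · rw [m7 j hj, m4 _ (by simpa using fun h => hj (hiv h)) (by simp)]
          simpa using this
      · intro x hx
        rw [m4 _ (by simpa using hx i) (by simp)]
        simpa using hJ.h0 x hx

theorem init_complete {iv : Fin n → V} (hiv : Function.Injective iv) {B C : ℕ} {a : Fin n → ℕ}
    (ha : ∀ i, a i ≤ B) : ∀ (k : ℕ) (s : K V n → ℕ), J iv B C a s → ∑ i, s (.inp i) = k →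
    ∃ s', LSem (initP iv) s s' ∧ J iv B C a s' ∧ ∀ i, s' (.inp i) = 0 := by
  intro k
  induction k with
  | zero =>
    intro s hJ hs
    exact ⟨s, .nil, hJ, fun i => by simpa using (Finset.sum_eq_zero_iff.1 hs) i⟩
  | succ k ih =>
    intro s hJ hs
    have : ∃ i, 0 < s (.inp i) := by
      by_contra hcon
      push Not at hcon
      rw [Finset.sum_eq_zero (fun i _ => Nat.le_zero.1 (hcon i))] at hs
      omega
    obtain ⟨i, hi⟩ := this
    have e1 := hJ.hin i
    have e2 := hJ.inv (iv i) true
    have e3 := ha i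
    obtain ⟨s1, h1⟩ := move_complete (x := iv i) (b := true)
      (s := Function.update s (.inp i) (s (.inp i) - 1)) (by simp at *; omega)
    have h2 : LSem (initStep iv i) s s1 := .seq (.dec hi) h1
    obtain ⟨hJ1, h3, h4⟩ := hJ.step hiv h2
    have hsum : ∑ j, s1 (.inp j) = k := by
      have a1 := Finset.add_sum_erase Finset.univ (fun j => s1 (.inp j)) (Finset.mem_univ i)
      have a2 := Finset.add_sum_erase Finset.univ (fun j => s (.inp j)) (Finset.mem_univ i)
      have a3 : ∑ j ∈ Finset.univ.erase i, s1 (.inp j) = ∑ j ∈ Finset.univ.erase i, s (.inp j) :=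
        Finset.sum_congr rfl fun j hj => h4 j (Finset.ne_of_mem_erase hj)
      omega
    obtain ⟨s', g1, g2⟩ := ih s1 hJ1 hsum
    exact ⟨s', .cons (anyP_complete _ _ (by simp) h2) g1, g2⟩

theorem clean_complete [Fintype V] : ∀ (k : ℕ) (s : K V n → ℕ),
    ∑ y : V × Bool, s (.cnt y.1 y.2) = k → s .c = 0 → s .d = 0 → (∀ i, s (.inp i) = 0) →
    LSem cleanP s (fun _ => 0) := by
  intro k
  induction k with
  | zero =>
    intro s hs hc hd hi
    have : s = fun _ => 0 := by
      funext z
      cases z with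
      | cnt x b => simpa using (Finset.sum_eq_zero_iff.1 hs) (x, b)
      | c => exact hc
      | d => exact hd
      | inp i => exact hi i
    rw [this]
    exact .nil
  | succ k ih =>
    intro s hs hc hd hi
    have : ∃ y : V × Bool, 0 < s (.cnt y.1 y.2) := by
      by_contra hcon
      push Not at hcon
      rw [Finset.sum_eq_zero (fun i _ => Nat.le_zero.1 (hcon i))] at hs
      omega
    obtain ⟨y, hy⟩ := this
    refine .cons (anyP_complete _ (.dec (.cnt y.1 y.2)) ?_ (.dec hy)) (ih _ ?_ ?_ ?_ ?_)
    · exact List.mem_map.2 ⟨y, by simp, rfl⟩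
    · set s1 := Function.update s (.cnt y.1 y.2) (s (.cnt y.1 y.2) - 1) with hs1
      have a1 := Finset.add_sum_erase Finset.univ
        (fun z : V × Bool => s1 (.cnt z.1 z.2)) (Finset.mem_univ y)
      have a2 := Finset.add_sum_erase Finset.univ
        (fun z : V × Bool => s (.cnt z.1 z.2)) (Finset.mem_univ y)
      have a3 : ∑ z ∈ Finset.univ.erase y, s1 (.cnt z.1 z.2) =
          ∑ z ∈ Finset.univ.erase y, s (.cnt z.1 z.2) :=
        Finset.sum_congr rfl fun z hz => by
          have hne := Finset.ne_of_mem_erase hz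
          rw [hs1, Function.update_of_ne]
          intro h
          apply hne
          injection h with h1 h2
          exact Prod.ext h1 h2
      have a4 : s1 (.cnt y.1 y.2) = s (.cnt y.1 y.2) - 1 := by simp [hs1]
      omega
    · simpa using hc
    · simpa using hd
    · intro i; simpa using hi i

theorem full_correct [Fintype V] {iv : Fin n → V} (hiv : Function.Injective iv) {B C : ℕ}
    {a : Fin n → ℕ} (ha : ∀ i, a i ≤ B) (p : Prog V) (f0 : V → ℕ) (hf : ∀ i, f0 (iv i) = a i)
    (hf0 : ∀ x, (∀ i, x ≠ iv i) → f0 x = 0) :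
    LSem (full iv p) (start B C a) (fun _ => 0) ↔ ∃ g, Sem B p f0 C g := by
  have hJ0 : J iv B C a (start B C a) := by
    refine ⟨.of fun x => ?_, rfl, rfl, fun i => ?_, fun x _ => rfl⟩ <;> simp [start]
  have hval : ∀ s : K V n → ℕ, J iv B C a s → (∀ i, s (.inp i) = 0) → val s = f0 := by
    intro s hJ hs
    funext x
    by_cases hx : ∀ i, x ≠ iv i
    · rw [hf0 x hx]; exact hJ.h0 x hx
    · push Not at hx
      obtain ⟨i, rfl⟩ := hx
      have := hJ.hin i
      rw [hf i, ← this, hs i]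
      simp [val]
  constructor
  · intro h
    cases h with
    | @seq _ _ _ s1 _ h1 h2 =>
      cases h2 with
      | @seq _ _ _ s2 _ h2 h3 =>
        have hJ1 : J iv B C a s1 := by
          refine LSem.star_inv (J iv B C a) ?_ h1 hJ0
          intro f g hJ hs
          rcases anyP_sound _ hs with rfl | ⟨q, hq, hs⟩
          · exact hJ
          · obtain ⟨i, -, rfl⟩ := List.mem_map.1 hq
            exact (hJ.step hiv hs).1
        obtain ⟨t1, t2, t, δ, t3, t4, t5, t6⟩ := tr_sound (B := B) p _ _ h2 hJ1.inv
        have hcl : ∀ z : K V n, (∀ x b, z ≠ .cnt x b) → 0 = s2 z := by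
          intro z hz
          refine LSem.star_inv (fun g => g z = s2 z) ?_ h3 rfl
          intro f g hfz hs
          rcases anyP_sound _ hs with rfl | ⟨q, hq, hs⟩
          · exact hfz
          · obtain ⟨y, -, rfl⟩ := List.mem_map.1 hq
            cases hs with
            | dec _ => rw [Function.update_of_ne (hz _ _)]; exact hfz
        have z1 := hcl .c (by simp)
        have z2 := hcl .d (by simp)
        have z3 : ∀ i, s1 (.inp i) = 0 := fun i => by
          rw [← t2 i, ← hcl (.inp i) (by simp)]
        have e1 := hJ1.hc
        have e2 := hJ1.hd
        have : t = C := by omega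
        subst this
        refine ⟨val s2, ?_⟩
        rw [← hval s1 hJ1 z3]
        exact t6 (by omega)
  · rintro ⟨g, hg⟩
    obtain ⟨s1, h1, hJ1, h2⟩ := init_complete hiv ha _ _ hJ0 rfl
    obtain ⟨s2, g1, g2, g3, g4⟩ := tr_complete hg s1 hJ1.inv (hval s1 hJ1 h2)
      hJ1.hc.ge hJ1.hd.ge
    have e1 := hJ1.hc
    have e2 := hJ1.hd
    have e3 := (tr_sound (B := B) p _ _ g1 hJ1.inv).2.1
    exact .seq h1 (.seq g1 (clean_complete _ s2 rfl (by omega) (by omega)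
      fun i => by rw [e3 i, h2 i]))

end Full

section Ideal

/-- Counters of the idealised program: formula variables and scratch counters. -/
inductive W (m : ℕ) : Type
  | var : Fin m → W m
  | u : W m
  | a : W m
  | b : W m
  | c : W m
  | e : W m
  deriving DecidableEq, Fintype

def mk {m : ℕ} (ρ : Fin m → ℕ) (u a b c e : ℕ) : W m → ℕ
  | .var w => ρ w
  | .u => u
  | .a => a
  | .b => b
  | .c => c
  | .e => e

variable {m : ℕ}

section mkLemmas
variable (ρ : Fin m → ℕ) (u a b c e v : ℕ)

@[simp] theorem mk_var (w : Fin m) : mk ρ u a b c e (.var w) = ρ w := rfl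
@[simp] theorem mk_u : mk ρ u a b c e .u = u := rfl
@[simp] theorem mk_a : mk ρ u a b c e .a = a := rfl
@[simp] theorem mk_b : mk ρ u a b c e .b = b := rfl
@[simp] theorem mk_c : mk ρ u a b c e .c = c := rfl
@[simp] theorem mk_e : mk ρ u a b c e .e = e := rfl
@[simp] theorem upd_u : Function.update (mk ρ u a b c e) .u v = mk ρ v a b c e := by
  funext z; cases z <;> simp
@[simp] theorem upd_a : Function.update (mk ρ u a b c e) .a v = mk ρ u v b c e := by
  funext z; cases z <;> simp
@[simp] theorem upd_b : Function.update (mk ρ u a b c e) .b v = mk ρ u a v c e := by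
  funext z; cases z <;> simp
@[simp] theorem upd_c : Function.update (mk ρ u a b c e) .c v = mk ρ u a b v e := by
  funext z; cases z <;> simp
@[simp] theorem upd_e : Function.update (mk ρ u a b c e) .e v = mk ρ u a b c v := by
  funext z; cases z <;> simp
@[simp] theorem upd_var (w : Fin m) : Function.update (mk ρ u a b c e) (.var w) v =
    mk (Function.update ρ w v) u a b c e := by
  funext z; cases z <;> simp [Function.update_apply]
end mkLemmas

variable {V : Type} [DecidableEq V]

def Out (B : ℕ) (p : Prog V) (f g : V → ℕ) : Prop := ∃ t, Sem B p f t g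
def Run (B : ℕ) (p : Prog V) (f g : V → ℕ) (q : ℕ) : Prop := ∃ t ≤ q, Sem B p f t g

variable {B : ℕ}

theorem out_inc {x : V} {f g : V → ℕ} :
    Out B (.inc x) f g ↔ f x < B ∧ g = Function.update f x (f x + 1) := by
  constructor
  · rintro ⟨t, h⟩; cases h with | inc h => exact ⟨h, rfl⟩
  · rintro ⟨h, rfl⟩; exact ⟨_, .inc h⟩

theorem out_dec {x : V} {f g : V → ℕ} :
    Out B (.dec x) f g ↔ 0 < f x ∧ g = Function.update f x (f x - 1) := by
  constructor
  · rintro ⟨t, h⟩; cases h with | dec h => exact ⟨h, rfl⟩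
  · rintro ⟨h, rfl⟩; exact ⟨_, .dec h⟩

theorem out_zt {x : V} {f g : V → ℕ} : Out B (.zt x) f g ↔ f x = 0 ∧ g = f := by
  constructor
  · rintro ⟨t, h⟩; cases h with | zt h => exact ⟨h, rfl⟩
  · rintro ⟨h, rfl⟩; exact ⟨_, .zt h⟩

theorem out_mt {x : V} {f g : V → ℕ} : Out B (.mt x) f g ↔ f x = B ∧ g = f := by
  constructor
  · rintro ⟨t, h⟩; cases h with | mt h => exact ⟨h, rfl⟩
  · rintro ⟨h, rfl⟩; exact ⟨_, .mt h⟩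

theorem out_seq {p q : Prog V} {f g : V → ℕ} :
    Out B (.seq p q) f g ↔ ∃ h, Out B p f h ∧ Out B q h g := by
  constructor
  · rintro ⟨t, h⟩; cases h with | seq h1 h2 => exact ⟨_, ⟨_, h1⟩, ⟨_, h2⟩⟩
  · rintro ⟨h, ⟨_, h1⟩, ⟨_, h2⟩⟩; exact ⟨_, .seq h1 h2⟩

theorem out_ch {p q : Prog V} {f g : V → ℕ} :
    Out B (.ch p q) f g ↔ Out B p f g ∨ Out B q f g := by
  constructor
  · rintro ⟨t, h⟩
    cases h with
    | chl h => exact .inl ⟨_, h⟩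
    | chr h => exact .inr ⟨_, h⟩
  · rintro (⟨_, h⟩ | ⟨_, h⟩)
    · exact ⟨_, .chl h⟩
    · exact ⟨_, .chr h⟩

theorem out_star {p : Prog V} (I : (V → ℕ) → Prop) {f g : V → ℕ}
    (h : Out B (.star p) f g) (hf : I f) (hp : ∀ f g, I f → Out B p f g → I g) : I g := by
  obtain ⟨t, h⟩ := h
  generalize hq : Prog.star p = q at h
  induction h with
  | nil => exact hf
  | cons h1 h2 _ ih2 =>
    cases hq
    exact ih2 (hp _ _ hf ⟨_, h1⟩) rfl
  | _ => cases hq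

theorem Run.to {p : Prog V} {f g g' : V → ℕ} {q q' : ℕ} (h : Run B p f g q) (hg : g = g')
    (hq : q ≤ q') : Run B p f g' q' := by
  subst hg
  obtain ⟨t, ht, h⟩ := h
  exact ⟨t, ht.trans hq, h⟩

theorem Run.inc {x : V} {f : V → ℕ} (h : f x < B) :
    Run B (.inc x) f (Function.update f x (f x + 1)) 0 := ⟨_, le_rfl, .inc h⟩
theorem Run.dec {x : V} {f : V → ℕ} (h : 0 < f x) :
    Run B (.dec x) f (Function.update f x (f x - 1)) 0 := ⟨_, le_rfl, .dec h⟩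
theorem Run.zt {x : V} {f : V → ℕ} (h : f x = 0) : Run B (.zt x) f f 1 := ⟨_, le_rfl, .zt h⟩
theorem Run.mt {x : V} {f : V → ℕ} (h : f x = B) : Run B (.mt x) f f 1 := ⟨_, le_rfl, .mt h⟩
theorem Run.seq {p p' : Prog V} {f g h : V → ℕ} {q q' : ℕ} (h1 : Run B p f g q)
    (h2 : Run B p' g h q') : Run B (.seq p p') f h (q + q') := by
  obtain ⟨t, ht, h1⟩ := h1
  obtain ⟨t', ht', h2⟩ := h2
  exact ⟨_, by omega, .seq h1 h2⟩
theorem Run.chl {p p' : Prog V} {f g : V → ℕ} {q : ℕ} (h1 : Run B p f g q) :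
    Run B (.ch p p') f g q := by
  obtain ⟨t, ht, h1⟩ := h1
  exact ⟨_, ht, .chl h1⟩
theorem Run.chr {p p' : Prog V} {f g : V → ℕ} {q : ℕ} (h1 : Run B p' f g q) :
    Run B (.ch p p') f g q := by
  obtain ⟨t, ht, h1⟩ := h1
  exact ⟨_, ht, .chr h1⟩

theorem Run.star {p : Prog V} {q : ℕ} : ∀ (k : ℕ) (F : ℕ → V → ℕ),
    (∀ i < k, Run B p (F i) (F (i + 1)) q) → Run B (.star p) (F 0) (F k) (k * q) := by
  intro k
  induction k with
  | zero => intro F _; exact ⟨0, by simp, .nil⟩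
  | succ k ih =>
    intro F h
    obtain ⟨t, ht, h1⟩ := h 0 (by omega)
    obtain ⟨t', ht', h2⟩ := ih (fun i => F (i + 1)) (fun i hi => h (i + 1) (by omega))
    exact ⟨t + t', by rw [Nat.succ_mul]; omega, .cons h1 h2⟩

/-! ### Copying -/

def cp (x : Fin m) (y : W m) : Prog (W m) :=
  .seq (.star (.seq (.dec (.var x)) (.seq (.inc .u) (.inc y))))
    (.seq (.zt (.var x)) (.seq (.star (.seq (.dec .u) (.inc (.var x)))) (.zt .u)))

/-- Deterministic behaviour of `p` on `f`, with cost bound `q`. -/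
def Det (B : ℕ) (p : Prog V) (f g : V → ℕ) (q : ℕ) : Prop :=
  (∀ g', Out B p f g' → g' = g) ∧ Run B p f g q

theorem Det.seq {p p' : Prog V} {f g h : V → ℕ} {q q' : ℕ} (h1 : Det B p f g q)
    (h2 : Det B p' g h q') : Det B (.seq p p') f h (q + q') := by
  refine ⟨fun g' hg => ?_, h1.2.seq h2.2⟩
  obtain ⟨f', a1, a2⟩ := out_seq.1 hg
  rw [h1.1 _ a1] at a2
  exact h2.1 _ a2

theorem cp_det {x : Fin m} {y : W m} {f : W m → ℕ} (hy : y ≠ .u) (hxy : y ≠ .var x)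
    (hu : f .u = 0) (hfy : f y = 0) (hx : f (.var x) ≤ B) :
    Det B (cp x y) f (Function.update f y (f (.var x))) 2 := by
  constructor
  · intro g hg
    simp only [cp, out_seq, out_zt] at hg
    obtain ⟨f1, h1, f2, ⟨h2, rfl⟩, f3, h3, h4, rfl⟩ := hg
    have I1 := out_star (fun g => g (.var x) + g .u = f (.var x) ∧ g y = g .u ∧
      ∀ z, z ≠ .var x → z ≠ .u → z ≠ y → g z = f z) h1 ⟨by omega, by omega, fun _ _ _ _ => rfl⟩ (by
        rintro f g ⟨i1, i2, i3⟩ h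
        simp only [out_seq, out_dec, out_inc] at h
        obtain ⟨_, ⟨h1, rfl⟩, _, ⟨h2, rfl⟩, h3, rfl⟩ := h
        refine ⟨?_, ?_, ?_⟩
        · simp [hxy.symm, hy.symm]; omega
        · simp [hxy, hy.symm, hy]; omega
        · intro z z1 z2 z3
          simp [z1, z2, z3, i3])
    obtain ⟨a1, a2, a3⟩ := I1
    have I2 := out_star (fun g => g (.var x) + g .u = f (.var x) ∧ g y = f (.var x) ∧
      ∀ z, z ≠ .var x → z ≠ .u → z ≠ y → g z = f z) h3 ⟨a1, by omega, a3⟩ (by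
        rintro f g ⟨i1, i2, i3⟩ h
        simp only [out_seq, out_dec, out_inc] at h
        obtain ⟨_, ⟨h1, rfl⟩, h2, rfl⟩ := h
        refine ⟨?_, ?_, ?_⟩
        · simp; omega
        · simp [hxy, hy]; omega
        · intro z z1 z2 z3
          simp [z1, z2, i3 z z1 z2 z3])
    obtain ⟨b1, b2, b3⟩ := I2
    funext z
    by_cases z3 : z = y
    · subst z3; simp [b2]
    · rw [Function.update_of_ne z3]
      by_cases z1 : z = .var x
      · subst z1; omega
      · by_cases z2 : z = .u
        · subst z2; omega
        · exact b3 z z1 z2 z3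
  · set v := f (.var x) with hv
    let G : ℕ → ℕ → ℕ → W m → ℕ := fun i j k =>
      Function.update (Function.update (Function.update f (.var x) i) .u j) y k
    have r1 : Run B (.star (.seq (.dec (.var x)) (.seq (.inc .u) (.inc y))))
        (G v 0 0) (G 0 v v) 0 := by
      have := Run.star (B := B) (p := .seq (.dec (.var x)) (.seq (.inc .u) (.inc y))) (q := 0) v
        (fun i => G (v - i) i i) (fun i hi => by
          refine Run.to (Run.seq (Run.dec ?_) (Run.seq (Run.inc ?_) (Run.inc ?_))) ?_ le_rfl
          · simp [G, hxy.symm]; omega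
          · simp [G, hy.symm]; omega
          · simp [G, hy, hxy]; omega
          · funext z
            simp only [G, Function.update_apply]
            split_ifs <;> simp_all <;> omega)
      simpa using this
    have r2 : Run B (.star (.seq (.dec .u) (.inc (.var x)))) (G 0 v v) (G v 0 v) 0 := by
      have := Run.star (B := B) (p := .seq (.dec .u) (.inc (.var x))) (q := 0) v
        (fun i => G i (v - i) v) (fun i hi => by
          refine Run.to (Run.seq (Run.dec ?_) (Run.inc ?_)) ?_ le_rfl
          · simp [G, hy.symm]; omega
          · simp [G, hxy.symm]; omega
          · funext z
            simp only [G, Function.update_apply]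
            split_ifs <;> simp_all <;> omega)
      simpa using this
    have e0 : f = G v 0 0 := by
      funext z
      simp only [G, Function.update_apply]
      split_ifs with h1 h2 h3
      · rw [h1, hfy]
      · rw [h2, hu]
      · rw [h3]
      · rfl
    have e1 : G v 0 v = Function.update f y v := by
      funext z
      simp only [G, Function.update_apply]
      split_ifs with h1 h2 h3
      · rfl
      · rw [h2, hu]
      · rw [h3]
      · rfl
    rw [← e1]
    nth_rewrite 1 [e0]
    refine Run.to (Run.seq r1 (Run.seq (Run.zt ?_) (Run.seq r2 (Run.zt ?_)))) rfl (by omega)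
    · simp [G, hxy.symm]
    · simp [G, hy.symm]

end Ideal

section Core

variable {m : ℕ} {B : ℕ}

def clr (x : W m) : Prog (W m) := .star (.dec x)

def roundP : Prog (W m) :=
  .seq (.star (.seq (.dec .b) (.seq (.dec .c) (.inc .u))))
    (.seq (.zt .b) (.seq (.star (.seq (.dec .u) (.inc .b))) (.zt .u)))

def coreT : Prog (W m) :=
  .seq (.star (.seq (.dec .e) (.dec .c))) (.seq (.zt .e)
    (.seq (.star (.seq (.dec .a) roundP)) (.seq (.zt .a) (.seq (.zt .c)
      (.seq (clr .b) (.zt .b))))))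

def partP : Prog (W m) :=
  .seq (.star (.seq (.dec .b) (.seq (.dec .c) (.inc .u))))
    (.seq (.dec .b) (.seq (.inc .u) (.seq (.star (.seq (.dec .u) (.inc .b))) (.zt .u))))

def coreF : Prog (W m) :=
  .ch (.seq (.dec .c) (.seq (clr .c) coreT))
    (.ch (.seq (.dec .e) (.seq (clr .e) (.seq (clr .a) coreT)))
      (.seq (.dec .a) (.seq (clr .a) (.seq partP coreT))))

theorem down_sound {ρ : Fin m → ℕ} {u a b c e : ℕ} {g : W m → ℕ}
    (h : Out B (.star (.seq (.dec .b) (.seq (.dec .c) (.inc .u)))) (mk ρ u a b c e) g) :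
    ∃ j b' c', b = b' + j ∧ c = c' + j ∧ g = mk ρ (u + j) a b' c' e := by
  refine out_star (fun g => ∃ j b' c', b = b' + j ∧ c = c' + j ∧ g = mk ρ (u + j) a b' c' e) h
    ⟨0, b, c, rfl, rfl, rfl⟩ ?_
  rintro f g ⟨j, b', c', rfl, rfl, rfl⟩ h
  simp only [out_seq, out_dec, out_inc] at h
  obtain ⟨_, ⟨h1, rfl⟩, _, ⟨h2, rfl⟩, h3, rfl⟩ := h
  simp at h1 h2 h3 ⊢
  exact ⟨j + 1, b' - 1, by omega, c' - 1, by omega, by simp [add_assoc]⟩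

theorem up_sound {ρ : Fin m → ℕ} {u a b c e : ℕ} {g : W m → ℕ}
    (h : Out B (.star (.seq (.dec .u) (.inc .b))) (mk ρ u a b c e) g) :
    ∃ j u', u = u' + j ∧ g = mk ρ u' a (b + j) c e := by
  refine out_star (fun g => ∃ j u', u = u' + j ∧ g = mk ρ u' a (b + j) c e) h
    ⟨0, u, rfl, rfl⟩ ?_
  rintro f g ⟨j, u', rfl, rfl⟩ h
  simp only [out_seq, out_dec, out_inc] at h
  obtain ⟨_, ⟨h1, rfl⟩, h3, rfl⟩ := h
  simp at h1 h3 ⊢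
  exact ⟨j + 1, u' - 1, by omega, by simp [add_assoc]⟩

theorem down_run {ρ : Fin m → ℕ} {u a b c e : ℕ} (j : ℕ) (h : u + j ≤ B) :
    Run B (.star (.seq (.dec .b) (.seq (.dec .c) (.inc .u)))) (mk ρ u a (b + j) (c + j) e)
      (mk ρ (u + j) a b c e) 0 := by
  have := Run.star (B := B) (p := .seq (.dec .b) (.seq (.dec .c) (.inc .u))) (q := 0) j
    (fun i => mk ρ (u + i) a (b + (j - i)) (c + (j - i)) e) (fun i hi => by
      refine Run.to (Run.seq (Run.dec ?_) (Run.seq (Run.dec ?_) (Run.inc ?_))) ?_ le_rfl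
      · simp; omega
      · simp; omega
      · simp; omega
      · simp only [mk_b, mk_c, mk_u, upd_b, upd_c, upd_u]; congr 1 <;> omega)
  simpa using this

theorem up_run {ρ : Fin m → ℕ} {u a b c e : ℕ} (j : ℕ) (h : b + j ≤ B) :
    Run B (.star (.seq (.dec .u) (.inc .b))) (mk ρ (u + j) a b c e)
      (mk ρ u a (b + j) c e) 0 := by
  have := Run.star (B := B) (p := .seq (.dec .u) (.inc .b)) (q := 0) j
    (fun i => mk ρ (u + (j - i)) a (b + i) c e) (fun i hi => by
      refine Run.to (Run.seq (Run.dec ?_) (Run.inc ?_)) ?_ le_rfl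
      · simp; omega
      · simp; omega
      · simp only [mk_b, mk_u, upd_b, upd_u]; congr 1 <;> omega)
  simpa using this

theorem round_sound {ρ : Fin m → ℕ} {a b c e : ℕ} {g : W m → ℕ}
    (h : Out B roundP (mk ρ 0 a b c e) g) : ∃ c', c = c' + b ∧ g = mk ρ 0 a b c' e := by
  simp only [roundP, out_seq, out_zt] at h
  obtain ⟨f1, h1, f2, ⟨h2, rfl⟩, f3, h3, h4, rfl⟩ := h
  obtain ⟨j, b', c', rfl, rfl, rfl⟩ := down_sound h1
  obtain ⟨j', u', h5, rfl⟩ := up_sound h3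
  simp at h2 h4
  subst h2 h4
  refine ⟨c', by omega, ?_⟩
  congr 1
  omega

theorem round_run {ρ : Fin m → ℕ} {a b c e : ℕ} (hb : b ≤ B) :
    Run B roundP (mk ρ 0 a b (c + b) e) (mk ρ 0 a b c e) 2 := by
  have h1 := down_run (B := B) (ρ := ρ) (u := 0) (a := a) (b := 0) (c := c) (e := e) b (by omega)
  have h2 := up_run (B := B) (ρ := ρ) (u := 0) (a := a) (b := 0) (c := c) (e := e) b (by omega)
  simp only [zero_add] at h1 h2
  exact (h1.seq ((Run.zt (by simp)).seq (h2.seq (Run.zt (by simp))))).to rfl (by omega)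

theorem part_sound {ρ : Fin m → ℕ} {a b c e : ℕ} {g : W m → ℕ}
    (h : Out B partP (mk ρ 0 a b c e) g) :
    ∃ r c', r < b ∧ c = c' + r ∧ g = mk ρ 0 a b c' e := by
  simp only [partP, out_seq, out_zt, out_dec, out_inc] at h
  obtain ⟨f1, h1, f2, ⟨h2, rfl⟩, f3, ⟨h3, rfl⟩, f4, h4, h5, rfl⟩ := h
  obtain ⟨j, b', c', rfl, rfl, rfl⟩ := down_sound h1
  simp at h2 h3 h4
  obtain ⟨j', u', h6, rfl⟩ := up_sound h4
  simp at h5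
  subst h5
  refine ⟨j, c', by omega, rfl, ?_⟩
  congr 1
  omega

theorem part_run {ρ : Fin m → ℕ} {a b c e r : ℕ} (hb : b ≤ B) (hr : r < b) :
    Run B partP (mk ρ 0 a b (c + r) e) (mk ρ 0 a b c e) 1 := by
  obtain ⟨b', rfl⟩ : ∃ b', b = b' + 1 + r := ⟨b - r - 1, by omega⟩
  have h1 := down_run (B := B) (ρ := ρ) (u := 0) (a := a) (b := b' + 1) (c := c) (e := e) r
    (by omega)
  have h2 := up_run (B := B) (ρ := ρ) (u := 0) (a := a) (b := b') (c := c) (e := e) (r + 1)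
    (by omega)
  simp only [zero_add] at h1 h2
  have h3 : Run B (.dec .b) (mk ρ r a (b' + 1) c e) (mk ρ r a b' c e) 0 :=
    (Run.dec (by simp)).to (by simp) le_rfl
  have h4 : Run B (.inc .u) (mk ρ r a b' c e) (mk ρ (r + 1) a b' c e) 0 :=
    (Run.inc (by simp; omega)).to (by simp) le_rfl
  refine (h1.seq (h3.seq (h4.seq (h2.seq (Run.zt (by simp)))))).to ?_ (by omega)
  congr 1
  omega

theorem clr_sound_a {ρ : Fin m → ℕ} {u a b c e : ℕ} {g : W m → ℕ}
    (h : Out B (clr .a) (mk ρ u a b c e) g) : ∃ a' ≤ a, g = mk ρ u a' b c e := by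
  refine out_star (fun g => ∃ a' ≤ a, g = mk ρ u a' b c e) h ⟨a, le_rfl, rfl⟩ ?_
  rintro f g ⟨a', h0, rfl⟩ h
  obtain ⟨h1, rfl⟩ := out_dec.1 h
  exact ⟨a' - 1, by omega, by simp⟩

theorem clr_sound_b {ρ : Fin m → ℕ} {u a b c e : ℕ} {g : W m → ℕ}
    (h : Out B (clr .b) (mk ρ u a b c e) g) : ∃ b' ≤ b, g = mk ρ u a b' c e := by
  refine out_star (fun g => ∃ b' ≤ b, g = mk ρ u a b' c e) h ⟨b, le_rfl, rfl⟩ ?_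
  rintro f g ⟨a', h0, rfl⟩ h
  obtain ⟨h1, rfl⟩ := out_dec.1 h
  exact ⟨a' - 1, by omega, by simp⟩

theorem clr_sound_c {ρ : Fin m → ℕ} {u a b c e : ℕ} {g : W m → ℕ}
    (h : Out B (clr .c) (mk ρ u a b c e) g) : ∃ c' ≤ c, g = mk ρ u a b c' e := by
  refine out_star (fun g => ∃ c' ≤ c, g = mk ρ u a b c' e) h ⟨c, le_rfl, rfl⟩ ?_
  rintro f g ⟨a', h0, rfl⟩ h
  obtain ⟨h1, rfl⟩ := out_dec.1 h
  exact ⟨a' - 1, by omega, by simp⟩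

theorem clr_sound_e {ρ : Fin m → ℕ} {u a b c e : ℕ} {g : W m → ℕ}
    (h : Out B (clr .e) (mk ρ u a b c e) g) : ∃ e' ≤ e, g = mk ρ u a b c e' := by
  refine out_star (fun g => ∃ e' ≤ e, g = mk ρ u a b c e') h ⟨e, le_rfl, rfl⟩ ?_
  rintro f g ⟨a', h0, rfl⟩ h
  obtain ⟨h1, rfl⟩ := out_dec.1 h
  exact ⟨a' - 1, by omega, by simp⟩

theorem clr_run (x : W m) (f : W m → ℕ) (v : ℕ) (hv : v ≤ f x) :
    Run B (clr x) f (Function.update f x v) 0 := by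
  have := Run.star (B := B) (p := .dec x) (q := 0) (f x - v)
    (fun i => Function.update f x (f x - i)) (fun i hi => by
      refine Run.to (Run.dec ?_) ?_ le_rfl
      · simp; omega
      · simp; congr 1)
  simp only [Nat.sub_zero, Function.update_eq_self, mul_zero] at this
  rwa [show f x - (f x - v) = v by omega] at this

theorem coreT_sound {ρ : Fin m → ℕ} {a b c e : ℕ} {g : W m → ℕ}
    (h : Out B coreT (mk ρ 0 a b c e) g) : a * b + e = c ∧ g = mk ρ 0 0 0 0 0 := by
  simp only [coreT, out_seq, out_zt] at h
  obtain ⟨f1, h1, f2, ⟨h2, rfl⟩, f3, h3, f4, ⟨h4, rfl⟩, f5, ⟨h5, rfl⟩, f6, h6, h7, rfl⟩ := h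
  have I1 : ∃ c' e', c + e' = c' + e ∧ f2 = mk ρ 0 a b c' e' := by
    refine out_star (fun g => ∃ c' e', c + e' = c' + e ∧ g = mk ρ 0 a b c' e') h1
      ⟨c, e, rfl, rfl⟩ ?_
    rintro f g ⟨c', e', h0, rfl⟩ h
    simp only [out_seq, out_dec] at h
    obtain ⟨_, ⟨h1, rfl⟩, h2, rfl⟩ := h
    simp at h1 h2 ⊢
    exact ⟨c' - 1, e' - 1, by omega, rfl⟩
  obtain ⟨c1, e1, i1, rfl⟩ := I1
  simp at h2
  subst h2
  have I2 : ∃ k a' c', a = a' + k ∧ c1 = c' + k * b ∧ f5 = mk ρ 0 a' b c' 0 := by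
    refine out_star (fun g => ∃ k a' c', a = a' + k ∧ c1 = c' + k * b ∧ g = mk ρ 0 a' b c' 0) h3
      ⟨0, a, c1, rfl, by simp, rfl⟩ ?_
    rintro f g ⟨k, a', c', ha, hc, rfl⟩ h
    simp only [out_seq, out_dec] at h
    obtain ⟨_, ⟨h1, rfl⟩, h2⟩ := h
    simp at h1 h2
    obtain ⟨c'', rfl, rfl⟩ := round_sound h2
    exact ⟨k + 1, a' - 1, c'', by omega, by rw [hc]; ring, rfl⟩
  obtain ⟨k, a', c', rfl, rfl, rfl⟩ := I2
  simp at h4 h5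
  subst h4 h5
  obtain ⟨b', -, rfl⟩ := clr_sound_b h6
  simp at h7
  subst h7
  refine ⟨?_, rfl⟩
  simp only [zero_add] at *
  omega

theorem coreT_run {ρ : Fin m → ℕ} {a b c e : ℕ} (ha : a ≤ B) (hb : b ≤ B)
    (h : a * b + e = c) : Run B coreT (mk ρ 0 a b c e) (mk ρ 0 0 0 0 0) (2 * B + 4) := by
  subst h
  have h1 : Run B (.star (.seq (.dec .e) (.dec .c))) (mk ρ 0 a b (a * b + e) e)
      (mk ρ 0 a b (a * b) 0) 0 := by
    have := Run.star (B := B) (p := .seq (.dec .e) (.dec .c)) (q := 0) e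
      (fun i => mk ρ 0 a b (a * b + (e - i)) (e - i)) (fun i hi => by
        refine Run.to (Run.seq (Run.dec ?_) (Run.dec ?_)) ?_ le_rfl
        · simp; omega
        · simp; omega
        · simp only [mk_e, mk_c, upd_e, upd_c]; congr 1; omega)
    simpa using this
  have h2 : Run B (.star (.seq (.dec .a) roundP)) (mk ρ 0 a b (a * b) 0)
      (mk ρ 0 0 b 0 0) (a * 2) := by
    have := Run.star (B := B) (p := .seq (.dec .a) roundP) (q := 2) a
      (fun i => mk ρ 0 (a - i) b ((a - i) * b) 0) (fun i hi => by
        obtain ⟨r, hr⟩ : ∃ r, a - i = r + 1 := ⟨a - i - 1, by omega⟩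
        have hr' : a - (i + 1) = r := by omega
        simp only [hr, hr', add_mul, one_mul]
        have h3 : Run B (.dec .a) (mk ρ 0 (r + 1) b (r * b + b) 0) (mk ρ 0 r b (r * b + b) 0) 0 :=
          (Run.dec (by simp)).to (by simp) le_rfl
        exact (h3.seq (round_run hb)).to rfl (by omega))
    simpa using this
  have h3 : Run B (clr .b) (mk ρ 0 0 b 0 0) (mk ρ 0 0 0 0 0) 0 :=
    (clr_run .b _ 0 (by simp)).to (by simp) le_rfl
  exact (h1.seq ((Run.zt (by simp)).seq (h2.seq ((Run.zt (by simp)).seq ((Run.zt (by simp)).seq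
    (h3.seq (Run.zt (by simp)))))))).to rfl (by omega)

theorem coreF_sound {ρ : Fin m → ℕ} {a b c e : ℕ} {g : W m → ℕ}
    (h : Out B coreF (mk ρ 0 a b c e) g) : a * b + e ≠ c ∧ g = mk ρ 0 0 0 0 0 := by
  simp only [coreF, out_seq, out_ch, out_dec] at h
  rcases h with ⟨_, ⟨h1, rfl⟩, f2, h2, h3⟩ | ⟨_, ⟨h1, rfl⟩, f2, h2, f3, h3, h4⟩ |
    ⟨_, ⟨h1, rfl⟩, f2, h2, f3, h3, h4⟩
  · simp at h1 h2
    obtain ⟨c', hc, rfl⟩ := clr_sound_c h2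
    obtain ⟨h4, rfl⟩ := coreT_sound h3
    exact ⟨by omega, rfl⟩
  · simp at h1 h2
    obtain ⟨c', hc, rfl⟩ := clr_sound_e h2
    obtain ⟨a', ha, rfl⟩ := clr_sound_a h3
    obtain ⟨h4, rfl⟩ := coreT_sound h4
    have := Nat.mul_le_mul_right b ha
    exact ⟨by omega, rfl⟩
  · simp at h1 h2
    obtain ⟨a', ha, rfl⟩ := clr_sound_a h2
    obtain ⟨r, c', hr, rfl, rfl⟩ := part_sound h3
    obtain ⟨h4, rfl⟩ := coreT_sound h4
    have : (a' + 1) * b ≤ a * b := Nat.mul_le_mul_right b (by omega)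
    rw [add_mul] at this
    exact ⟨by omega, rfl⟩

theorem coreF_run {ρ : Fin m → ℕ} {a b c e : ℕ} (ha : a ≤ B) (hb : b ≤ B)
    (h : a * b + e ≠ c) : Run B coreF (mk ρ 0 a b c e) (mk ρ 0 0 0 0 0) (2 * B + 5) := by
  rcases lt_or_gt_of_ne h with h | h
  · refine Run.chl ?_
    have h1 : Run B (.dec .c) (mk ρ 0 a b c e) (mk ρ 0 a b (c - 1) e) 0 :=
      (Run.dec (by simp; omega)).to (by simp) le_rfl
    have h2 : Run B (clr .c) (mk ρ 0 a b (c - 1) e) (mk ρ 0 a b (a * b + e) e) 0 :=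
      (clr_run .c _ (a * b + e) (by simp; omega)).to (by simp) le_rfl
    exact (h1.seq (h2.seq (coreT_run ha hb rfl))).to rfl (by omega)
  · refine Run.chr ?_
    by_cases hc : c < e
    · refine Run.chl ?_
      have h1 : Run B (.dec .e) (mk ρ 0 a b c e) (mk ρ 0 a b c (e - 1)) 0 :=
        (Run.dec (by simp; omega)).to (by simp) le_rfl
      have h2 : Run B (clr .e) (mk ρ 0 a b c (e - 1)) (mk ρ 0 a b c c) 0 :=
        (clr_run .e _ c (by simp; omega)).to (by simp) le_rfl
      have h3 : Run B (clr .a) (mk ρ 0 a b c c) (mk ρ 0 0 b c c) 0 :=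
        (clr_run .a _ 0 (by simp)).to (by simp) le_rfl
      exact (h1.seq (h2.seq (h3.seq (coreT_run (by omega) hb (by simp))))).to rfl (by omega)
    · refine Run.chr ?_
      obtain ⟨x, rfl⟩ : ∃ x, c = x + e := ⟨c - e, by omega⟩
      have hx : x < a * b := by omega
      have hb0 : 0 < b := by
        rcases Nat.eq_zero_or_pos b with h | h
        · subst h; simp at hx
        · exact h
      have hq : x / b < a := by rw [Nat.div_lt_iff_lt_mul hb0]; exact hx
      have hr := Nat.mod_lt x hb0
      have hd : x / b * b + x % b = x := Nat.div_add_mod' x b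
      generalize x / b = q at *
      generalize x % b = r at *
      have h1 : Run B (.dec .a) (mk ρ 0 a b (x + e) e) (mk ρ 0 (a - 1) b (x + e) e) 0 :=
        (Run.dec (by simp; omega)).to (by simp) le_rfl
      have h2 : Run B (clr .a) (mk ρ 0 (a - 1) b (x + e) e) (mk ρ 0 q b (q * b + e + r) e) 0 :=
        (clr_run .a _ q (by simp; omega)).to (by simp; congr 1; omega) le_rfl
      exact (h1.seq (h2.seq ((part_run hb hr).seq (coreT_run (by omega) hb rfl)))).to rfl
        (by omega)

/-! ### Checking programs -/

def st (ρ : Fin m → ℕ) : W m → ℕ := mk ρ 0 0 0 0 0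

def Chk (B : ℕ) (p : Prog (W m)) (ρ : Fin m → ℕ) (q : ℕ) (P : Prop) : Prop :=
  (∀ g, Out B p (st ρ) g → P ∧ g = st ρ) ∧ (P → Run B p (st ρ) (st ρ) q)

theorem Chk.mono {p : Prog (W m)} {ρ : Fin m → ℕ} {q q' : ℕ} {P P' : Prop}
    (h : Chk B p ρ q P) (hq : q ≤ q') (hP : P ↔ P') : Chk B p ρ q' P' := by
  rw [← hP]
  exact ⟨h.1, fun hp => (h.2 hp).to rfl hq⟩

theorem Chk.seq {p p' : Prog (W m)} {ρ : Fin m → ℕ} {q q' : ℕ} {P P' : Prop}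
    (h : Chk B p ρ q P) (h' : Chk B p' ρ q' P') : Chk B (.seq p p') ρ (q + q') (P ∧ P') := by
  refine ⟨fun g hg => ?_, fun hp => (h.2 hp.1).seq (h'.2 hp.2)⟩
  obtain ⟨f, h1, h2⟩ := out_seq.1 hg
  obtain ⟨h3, rfl⟩ := h.1 _ h1
  obtain ⟨h4, rfl⟩ := h'.1 _ h2
  exact ⟨⟨h3, h4⟩, rfl⟩

theorem Chk.ch {p p' : Prog (W m)} {ρ : Fin m → ℕ} {q q' : ℕ} {P P' : Prop}
    (h : Chk B p ρ q P) (h' : Chk B p' ρ q' P') : Chk B (.ch p p') ρ (q + q') (P ∨ P') := by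
  refine ⟨fun g hg => ?_, fun hp => ?_⟩
  · rcases out_ch.1 hg with hg | hg
    · exact ⟨.inl (h.1 _ hg).1, (h.1 _ hg).2⟩
    · exact ⟨.inr (h'.1 _ hg).1, (h'.1 _ hg).2⟩
  · rcases hp with hp | hp
    · exact (h.2 hp).chl.to rfl (by omega)
    · exact (h'.2 hp).chr.to rfl (by omega)

theorem chk_false {ρ : Fin m → ℕ} {q : ℕ} : Chk B (.dec .u) ρ q False := by
  refine ⟨fun g hg => ?_, False.elim⟩
  have := (out_dec.1 hg).1
  simp [st] at this

theorem chk_true {ρ : Fin m → ℕ} : Chk B (.zt .u) ρ 1 True :=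
  ⟨fun _ hg => ⟨trivial, (out_zt.1 hg).2⟩, fun _ => Run.zt (by simp [st])⟩

theorem chk_core {ld : Prog (W m)} {ρ : Fin m → ℕ} {a b c e q : ℕ}
    (hd : Det B ld (st ρ) (mk ρ 0 a b c e) q) (ha : a ≤ B) (hb : b ≤ B) :
    Chk B (.seq ld coreT) ρ (q + (2 * B + 5)) (a * b + e = c) ∧
    Chk B (.seq ld coreF) ρ (q + (2 * B + 5)) (¬ (a * b + e = c)) := by
  refine ⟨⟨fun g hg => ?_, fun hp => ?_⟩, ⟨fun g hg => ?_, fun hp => ?_⟩⟩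
  · obtain ⟨f, h1, h2⟩ := out_seq.1 hg
    rw [hd.1 _ h1] at h2
    exact coreT_sound h2
  · exact (hd.2.seq (coreT_run ha hb hp)).to rfl (by omega)
  · obtain ⟨f, h1, h2⟩ := out_seq.1 hg
    rw [hd.1 _ h1] at h2
    exact coreF_sound h2
  · exact (hd.2.seq (coreF_run ha hb hp)).to rfl (by omega)

theorem ld_a {ρ : Fin m → ℕ} {b c e : ℕ} (x : Fin m) (hx : ρ x ≤ B) :
    Det B (cp x .a) (mk ρ 0 0 b c e) (mk ρ 0 (ρ x) b c e) 2 := by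
  have := cp_det (B := B) (x := x) (y := .a) (f := mk ρ 0 0 b c e) (by simp) (by simp) rfl rfl hx
  simpa using this
theorem ld_b {ρ : Fin m → ℕ} {a c e : ℕ} (x : Fin m) (hx : ρ x ≤ B) :
    Det B (cp x .b) (mk ρ 0 a 0 c e) (mk ρ 0 a (ρ x) c e) 2 := by
  have := cp_det (B := B) (x := x) (y := .b) (f := mk ρ 0 a 0 c e) (by simp) (by simp) rfl rfl hx
  simpa using this
theorem ld_c {ρ : Fin m → ℕ} {a b e : ℕ} (x : Fin m) (hx : ρ x ≤ B) :
    Det B (cp x .c) (mk ρ 0 a b 0 e) (mk ρ 0 a b (ρ x) e) 2 := by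
  have := cp_det (B := B) (x := x) (y := .c) (f := mk ρ 0 a b 0 e) (by simp) (by simp) rfl rfl hx
  simpa using this
theorem ld_e {ρ : Fin m → ℕ} {a b c : ℕ} (x : Fin m) (hx : ρ x ≤ B) :
    Det B (cp x .e) (mk ρ 0 a b c 0) (mk ρ 0 a b c (ρ x)) 2 := by
  have := cp_det (B := B) (x := x) (y := .e) (f := mk ρ 0 a b c 0) (by simp) (by simp) rfl rfl hx
  simpa using this
theorem ld_one {ρ : Fin m → ℕ} {a c e : ℕ} (hB : 0 < B) :
    Det B (.inc .b) (mk ρ 0 a 0 c e) (mk ρ 0 a 1 c e) 0 := by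
  refine ⟨fun g hg => ?_, (Run.inc (by simpa using hB)).to (by simp) le_rfl⟩
  rw [(out_inc.1 hg).2]; simp

/-! ### Quantifiers -/

def allP (w : Fin m) (p : Prog (W m)) : Prog (W m) :=
  .seq p (.seq (.star (.seq (.inc (.var w)) (.seq (.inc (.var w)) (.seq (.dec (.var w)) p))))
    (.seq (.inc (.var w)) (.seq (.mt (.var w)) (.seq (clr (.var w)) (.zt (.var w))))))

def exP (w : Fin m) (p : Prog (W m)) : Prog (W m) :=
  .seq (.star (.inc (.var w))) (.seq (.inc (.var w)) (.seq (.dec (.var w)) (.seq p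
    (.seq (clr (.var w)) (.zt (.var w))))))

theorem upd_st (ρ : Fin m → ℕ) (w : Fin m) (v : ℕ) :
    Function.update (st ρ) (.var w) v = st (Function.update ρ w v) := by simp [st]

theorem st_var (ρ : Fin m → ℕ) (w : Fin m) : st ρ (.var w) = ρ w := rfl

theorem clr_var {ρ : Fin m → ℕ} {w : Fin m} {j : ℕ} {g : W m → ℕ}
    (h : Out B (clr (.var w)) (st (Function.update ρ w j)) g) :
    ∃ j', g = st (Function.update ρ w j') := by
  refine out_star (fun g => ∃ j', g = st (Function.update ρ w j')) h ⟨j, rfl⟩ ?_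
  rintro f g ⟨a', rfl⟩ h
  obtain ⟨h1, rfl⟩ := out_dec.1 h
  exact ⟨a' - 1, by simp [upd_st, st_var]⟩

theorem inc_var_run {ρ : Fin m → ℕ} {w : Fin m} {j : ℕ} (hj : j < B) :
    Run B (.inc (.var w)) (st (Function.update ρ w j)) (st (Function.update ρ w (j + 1))) 0 :=
  (Run.inc (by simpa [st_var] using hj)).to (by simp [upd_st, st_var]) le_rfl

theorem dec_var_run {ρ : Fin m → ℕ} {w : Fin m} {j : ℕ} :
    Run B (.dec (.var w)) (st (Function.update ρ w (j + 1))) (st (Function.update ρ w j)) 0 :=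
  (Run.dec (by simp [st_var])).to (by simp [upd_st, st_var]) le_rfl

theorem clr_var_run {ρ : Fin m → ℕ} {w : Fin m} (hw : ρ w = 0) {j : ℕ} :
    Run B (.seq (clr (.var w)) (.zt (.var w))) (st (Function.update ρ w j)) (st ρ) 1 := by
  have hρ : Function.update ρ w 0 = ρ := by rw [← hw]; simp
  have h1 : Run B (clr (.var w)) (st (Function.update ρ w j)) (st ρ) 0 :=
    (clr_run (.var w) _ 0 (by simp)).to (by simp [upd_st, hρ]) le_rfl
  exact (h1.seq (Run.zt (by simpa [st_var] using hw))).to rfl (by omega)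

theorem chk_all {N q : ℕ} {ρ : Fin m → ℕ} {w : Fin m} (hw : ρ w = 0) {p : Prog (W m)}
    {P : ℕ → Prop} (h : ∀ j ≤ N, Chk (N + 1) p (Function.update ρ w j) q (P j)) :
    Chk (N + 1) (allP w p) ρ ((N + 1) * q + 2) (∀ j ≤ N, P j) := by
  have hρ : Function.update ρ w 0 = ρ := by rw [← hw]; simp
  have h0 := h 0 (by omega)
  rw [hρ] at h0
  constructor
  · intro g hg
    simp only [allP, out_seq, out_inc, out_mt, out_zt] at hg
    obtain ⟨f1, h1, f2, h2, _, ⟨h3, rfl⟩, _, ⟨h4, rfl⟩, f4, h5, h6, rfl⟩ := hg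
    obtain ⟨p0, rfl⟩ := h0.1 _ h1
    have I : ∃ j ≤ N, (∀ i ≤ j, P i) ∧ f2 = st (Function.update ρ w j) := by
      refine out_star (fun g => ∃ j ≤ N, (∀ i ≤ j, P i) ∧ g = st (Function.update ρ w j)) h2
        ⟨0, by omega, ?_, by rw [hρ]⟩ ?_
      · intro i hi; obtain rfl : i = 0 := by omega
        exact p0
      · rintro f g ⟨j, hj, hP, rfl⟩ hs
        simp only [out_seq, out_inc, out_dec] at hs
        obtain ⟨_, ⟨g1, rfl⟩, _, ⟨g1', rfl⟩, _, ⟨_, rfl⟩, g2⟩ := hs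
        simp only [st_var, upd_st, Function.update_self, Function.update_idem,
          Nat.add_sub_cancel] at g1 g1' g2
        obtain ⟨g3, g4⟩ := (h (j + 1) (by omega)).1 _ g2
        refine ⟨j + 1, by omega, fun i hi => ?_, g4⟩
        rcases Nat.lt_or_ge i (j + 1) with hi' | hi'
        · exact hP i (by omega)
        · obtain rfl : i = j + 1 := by omega
          exact g3
    obtain ⟨j, hj, hP, rfl⟩ := I
    simp only [st_var, upd_st, Function.update_self, Function.update_idem] at h3 h4 h5
    obtain ⟨j', rfl⟩ := clr_var h5
    simp [st_var] at h6
    subst h6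
    exact ⟨fun i hi => hP i (by omega), by rw [hρ]⟩
  · intro hP
    have r0 := h0.2 (hP 0 (by omega))
    have r1 := Run.star (B := N + 1)
      (p := .seq (.inc (.var w)) (.seq (.inc (.var w)) (.seq (.dec (.var w)) p))) (q := q) N
      (fun i => st (Function.update ρ w i)) (fun i hi =>
        ((inc_var_run (by omega)).seq ((inc_var_run (by omega)).seq (dec_var_run.seq
          ((h (i + 1) (by omega)).2 (hP _ (by omega)))))).to rfl (by omega))
    simp only [hρ] at r1
    have r2 : Run (N + 1) (.inc (.var w)) (st (Function.update ρ w N))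
      (st (Function.update ρ w (N + 1))) 0 := inc_var_run (by omega)
    have r3 : Run (N + 1) (.mt (.var w)) (st (Function.update ρ w (N + 1)))
      (st (Function.update ρ w (N + 1))) 1 := Run.mt (by simp [st_var])
    exact (r0.seq (r1.seq (r2.seq (r3.seq (clr_var_run hw))))).to rfl
      (by rw [Nat.add_mul]; omega)

theorem chk_ex {N q : ℕ} {ρ : Fin m → ℕ} {w : Fin m} (hw : ρ w = 0) {p : Prog (W m)}
    {P : ℕ → Prop} (h : ∀ j ≤ N, Chk (N + 1) p (Function.update ρ w j) q (P j)) :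
    Chk (N + 1) (exP w p) ρ (q + 1) (∃ j ≤ N, P j) := by
  have hρ : Function.update ρ w 0 = ρ := by rw [← hw]; simp
  constructor
  · intro g hg
    simp only [exP, out_seq, out_inc, out_dec, out_zt] at hg
    obtain ⟨f1, h1, _, ⟨h2, rfl⟩, _, ⟨_, rfl⟩, f3, h3, f4, h5, h6, rfl⟩ := hg
    have I : ∃ j, f1 = st (Function.update ρ w j) := by
      refine out_star (fun g => ∃ j, g = st (Function.update ρ w j)) h1 ⟨0, by rw [hρ]⟩ ?_
      rintro f g ⟨j, rfl⟩ hs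
      obtain ⟨_, rfl⟩ := out_inc.1 hs
      exact ⟨j + 1, by simp [upd_st, st_var]⟩
    obtain ⟨j, rfl⟩ := I
    simp only [st_var, upd_st, Function.update_self, Function.update_idem,
      Nat.add_sub_cancel] at h2 h3
    obtain ⟨g3, rfl⟩ := (h j (by omega)).1 _ h3
    obtain ⟨j', rfl⟩ := clr_var h5
    simp [st_var] at h6
    subst h6
    exact ⟨⟨j, by omega, g3⟩, by rw [hρ]⟩
  · rintro ⟨j, hj, hP⟩
    have r1 := Run.star (B := N + 1) (p := .inc (.var w)) (q := 0) j
      (fun i => st (Function.update ρ w i)) (fun i hi => inc_var_run (by omega))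
    simp only [hρ] at r1
    have r2 : Run (N + 1) (.inc (.var w)) (st (Function.update ρ w j))
      (st (Function.update ρ w (j + 1))) 0 := inc_var_run (by omega)
    exact (r1.seq (r2.seq (dec_var_run.seq (((h j hj).2 hP).seq (clr_var_run hw))))).to rfl
      (by omega)

end Core

section FO

open FirstOrder.Language

def Agree (m N : ℕ) {n k : ℕ} (xs : Fin n → Fin (N + 1)) (ys : Fin k → Fin (N + 1))
    (ρ : Fin m → ℕ) : Prop :=
  (∀ w, ρ w ≤ N) ∧ (∀ (i : Fin n) (h : i.1 < m), ρ ⟨i.1, h⟩ = xs i) ∧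
  (∀ (j : Fin k) (h : n + j.1 < m), ρ ⟨n + j.1, h⟩ = ys j) ∧
  (∀ w : Fin m, n + k ≤ w.1 → ρ w = 0)

theorem Agree.snoc {m N n k : ℕ} {xs : Fin n → Fin (N + 1)} {ys : Fin k → Fin (N + 1)}
    {ρ : Fin m → ℕ} (h : Agree m N xs ys ρ) (hm : n + k < m) (x : Fin (N + 1)) :
    Agree m N xs (Fin.snoc ys x : Fin (k + 1) → Fin (N + 1))
      (Function.update ρ ⟨n + k, hm⟩ x) := by
  obtain ⟨h1, h2, h3, h4⟩ := h
  refine ⟨fun w => ?_, fun i hi => ?_, fun j hj => ?_, fun w hw => ?_⟩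
  · rw [Function.update_apply]
    split_ifs
    · have := x.2; omega
    · exact h1 w
  · rw [Function.update_of_ne, h2]
    rw [Ne, Fin.mk.injEq]
    have := i.2
    omega
  · rcases Fin.eq_castSucc_or_eq_last j with ⟨j, rfl⟩ | rfl
    · rw [Function.update_of_ne]
      · rw [Fin.snoc_castSucc]
        exact h3 j hj
      · rw [Ne, Fin.mk.injEq]
        have := j.2
        simp only [Fin.val_castSucc]
        omega
    · simp
  · rw [Function.update_of_ne]
    · exact h4 w (by omega)
    · rintro rfl
      simp only at hw
      omega

theorem term_idx {n k m : ℕ} (hm : n + k ≤ m) (t : arithLang.Term (Fin n ⊕ Fin k)) :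
    ∃ w : Fin m, ∀ (N : ℕ) (xs : Fin n → Fin (N + 1)) (ys : Fin k → Fin (N + 1)) (ρ : Fin m → ℕ),
      Agree m N xs ys ρ →
        ((letI := segStructure N; t.realize (Sum.elim xs ys) : Fin (N + 1)) : ℕ) = ρ w := by
  cases t with
  | var s =>
    rcases s with i | j
    · refine ⟨⟨i.1, by omega⟩, fun N xs ys ρ h => ?_⟩
      rw [h.2.1]; rfl
    · refine ⟨⟨n + j.1, by omega⟩, fun N xs ys ρ h => ?_⟩
      rw [h.2.2.1]; rfl
  | func f _ => exact (f : Empty).elim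

def Spec {n k : ℕ} (φ : arithLang.BoundedFormula (Fin n) k) (m : ℕ) : Prop :=
  ∃ (T F : Prog (W m)) (q : Polynomial ℕ), ∀ (N : ℕ) (xs : Fin n → Fin (N + 1))
    (ys : Fin k → Fin (N + 1)) (ρ : Fin m → ℕ), Agree m N xs ys ρ →
      (letI := segStructure N
       Chk (N + 1) T ρ (q.eval N) (φ.Realize xs ys) ∧
       Chk (N + 1) F ρ (q.eval N) (¬ φ.Realize xs ys))

theorem spec_of_core {n k m : ℕ} (φ : arithLang.BoundedFormula (Fin n) k) (ld : Prog (W m))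
    (h : ∀ (N : ℕ) (xs : Fin n → Fin (N + 1)) (ys : Fin k → Fin (N + 1)) (ρ : Fin m → ℕ),
      Agree m N xs ys ρ → ∃ a b c e, Det (N + 1) ld (st ρ) (mk ρ 0 a b c e) 6 ∧ a ≤ N + 1 ∧
        b ≤ N + 1 ∧ (letI := segStructure N; φ.Realize xs ys ↔ a * b + e = c)) : Spec φ m := by
  refine ⟨.seq ld coreT, .seq ld coreF, Polynomial.C 2 * Polynomial.X + Polynomial.C 13, ?_⟩
  intro N xs ys ρ hA
  obtain ⟨a, b, c, e, hd, ha, hb, hi⟩ := h N xs ys ρ hA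
  have := chk_core hd ha hb
  have hq : (6 + (2 * (N + 1) + 5)) ≤
      (Polynomial.C 2 * Polynomial.X + Polynomial.C 13 : Polynomial ℕ).eval N := by
    simp only [Polynomial.eval_add, Polynomial.eval_mul, Polynomial.eval_C, Polynomial.eval_X]
    omega
  exact ⟨this.1.mono hq hi.symm, this.2.mono hq (not_congr hi.symm)⟩

theorem Det.le {V : Type} [DecidableEq V] {B : ℕ} {p : Prog V} {f g : V → ℕ} {q q' : ℕ}
    (h : Det B p f g q) (hq : q ≤ q') : Det B p f g q' := ⟨h.1, h.2.to rfl hq⟩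

theorem spec_all {n k : ℕ} (φ : arithLang.BoundedFormula (Fin n) k) :
    ∃ m0, ∀ m ≥ m0, Spec φ m := by
  induction φ with
  | falsum =>
    refine ⟨0, fun m _ => ⟨.dec .u, .zt .u, 1, fun N xs ys ρ hA => ⟨?_, ?_⟩⟩⟩
    · exact chk_false
    · exact chk_true.mono (by simp) (iff_of_true trivial id)
  | @equal k t₁ t₂ =>
    refine ⟨n + k, fun m hm => ?_⟩
    obtain ⟨x, hx⟩ := term_idx hm t₁
    obtain ⟨y, hy⟩ := term_idx hm t₂
    refine spec_of_core _ (.seq (cp x .e) (cp y .c)) fun N xs ys ρ hA =>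
      ⟨0, 0, ρ y, ρ x, ?_, by omega, by omega, ?_⟩
    · exact ((ld_e x (by have := hA.1 x; omega)).seq (ld_c y (by have := hA.1 y; omega))).le
        (by omega)
    · rw [← hx N xs ys ρ hA, ← hy N xs ys ρ hA, zero_mul, zero_add, Fin.val_inj]
      exact Iff.rfl
  | @rel k l R ts =>
    refine ⟨n + k, fun m hm => ?_⟩
    choose ix hix using fun i => term_idx hm (ts i)
    cases R with
    | add =>
      refine spec_of_core _ (.seq (cp (ix 0) .a) (.seq (.inc .b) (.seq (cp (ix 1) .e)
        (cp (ix 2) .c)))) fun N xs ys ρ hA =>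
        ⟨ρ (ix 0), 1, ρ (ix 2), ρ (ix 1), ?_, ?_, by omega, ?_⟩
      · exact ((ld_a _ (by have := hA.1 (ix 0); omega)).seq ((ld_one (by omega)).seq
          ((ld_e _ (by have := hA.1 (ix 1); omega)).seq
            (ld_c _ (by have := hA.1 (ix 2); omega))))).le (by omega)
      · have := hA.1 (ix 0); omega
      · rw [← hix 0 N xs ys ρ hA, ← hix 1 N xs ys ρ hA, ← hix 2 N xs ys ρ hA, mul_one]
        exact Iff.rfl
    | mul =>
      refine spec_of_core _ (.seq (cp (ix 0) .a) (.seq (cp (ix 1) .b)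
        (cp (ix 2) .c))) fun N xs ys ρ hA =>
        ⟨ρ (ix 0), ρ (ix 1), ρ (ix 2), 0, ?_, ?_, ?_, ?_⟩
      · exact ((ld_a _ (by have := hA.1 (ix 0); omega)).seq
          ((ld_b _ (by have := hA.1 (ix 1); omega)).seq
            (ld_c _ (by have := hA.1 (ix 2); omega)))).le (by omega)
      · have := hA.1 (ix 0); omega
      · have := hA.1 (ix 1); omega
      · rw [← hix 0 N xs ys ρ hA, ← hix 1 N xs ys ρ hA, ← hix 2 N xs ys ρ hA, add_zero]
        exact Iff.rfl
  | imp φ ψ ih1 ih2 =>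
    obtain ⟨m1, h1⟩ := ih1
    obtain ⟨m2, h2⟩ := ih2
    refine ⟨max m1 m2, fun m hm => ?_⟩
    obtain ⟨T1, F1, q1, h1⟩ := h1 m (le_trans (le_max_left _ _) hm)
    obtain ⟨T2, F2, q2, h2⟩ := h2 m (le_trans (le_max_right _ _) hm)
    refine ⟨.ch F1 T2, .seq T1 F2, q1 + q2, fun N xs ys ρ hA => ?_⟩
    letI := segStructure N
    obtain ⟨a1, a2⟩ := h1 N xs ys ρ hA
    obtain ⟨b1, b2⟩ := h2 N xs ys ρ hA
    refine ⟨(a2.ch b1).mono (by simp) ?_, (a1.seq b2).mono (by simp) ?_⟩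
    · rw [BoundedFormula.realize_imp]; tauto
    · rw [BoundedFormula.realize_imp]; tauto
  | @all k φ ih =>
    obtain ⟨m0, h0⟩ := ih
    refine ⟨max m0 (n + k + 1), fun m hm => ?_⟩
    have hmk : n + k < m := le_trans (le_max_right _ _) hm
    obtain ⟨T, F, q, h⟩ := h0 m (le_trans (le_max_left _ _) hm)
    refine ⟨allP ⟨n + k, hmk⟩ T, exP ⟨n + k, hmk⟩ F, (Polynomial.X + 1) * q + Polynomial.C 2,
      fun N xs ys ρ hA => ?_⟩
    letI := segStructure N
    have hw : ρ ⟨n + k, hmk⟩ = 0 := hA.2.2.2 _ le_rfl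
    have hq : ((Polynomial.X + 1) * q + Polynomial.C 2 : Polynomial ℕ).eval N =
      (N + 1) * q.eval N + 2 := by simp
    rw [hq]
    let P : ℕ → Prop := fun j => ∀ hj : j < N + 1,
      φ.Realize xs (Fin.snoc ys (⟨j, hj⟩ : Fin (N + 1)))
    let Q : ℕ → Prop := fun j => ∃ hj : j < N + 1,
      ¬ φ.Realize xs (Fin.snoc ys (⟨j, hj⟩ : Fin (N + 1)))
    have hP : ∀ j ≤ N, Chk (N + 1) T (Function.update ρ ⟨n + k, hmk⟩ j) (q.eval N) (P j) := by
      intro j hj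
      exact (h N xs _ _ (hA.snoc hmk ⟨j, by omega⟩)).1.mono le_rfl
        ⟨fun x _ => x, fun x => x (by omega)⟩
    have hQ : ∀ j ≤ N, Chk (N + 1) F (Function.update ρ ⟨n + k, hmk⟩ j) (q.eval N) (Q j) := by
      intro j hj
      exact (h N xs _ _ (hA.snoc hmk ⟨j, by omega⟩)).2.mono le_rfl
        ⟨fun x => ⟨by omega, x⟩, fun ⟨_, x⟩ => x⟩
    refine ⟨(chk_all hw hP).mono le_rfl ?_, (chk_ex hw hQ).mono ?_ ?_⟩
    · rw [BoundedFormula.realize_all]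
      exact ⟨fun x a => x a.1 (by omega) a.2, fun x j _ hj => x ⟨j, hj⟩⟩
    · rw [Nat.add_mul]; omega
    · rw [BoundedFormula.realize_all, not_forall]
      exact ⟨fun ⟨j, _, hj, x⟩ => ⟨⟨j, hj⟩, x⟩, fun ⟨a, x⟩ => ⟨a.1, by omega, a.2, x⟩⟩

theorem pad_run {m B : ℕ} {f : W m → ℕ} (hu : f .u = 0) :
    ∀ k, Sem B (.star (.zt .u)) f k f := by
  intro k
  induction k with
  | zero => exact .nil
  | succ k ih => rw [add_comm]; exact .cons (.zt hu) ih

theorem pad_iff {m B C : ℕ} {p : Prog (W m)} {ρ : Fin m → ℕ} {P : Prop} (h : Chk B p ρ C P) :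
    (∃ g, Sem B (.seq p (.star (.zt .u))) (st ρ) C g) ↔ P := by
  constructor
  · rintro ⟨g, hg⟩
    obtain ⟨f, h1, _⟩ := out_seq.1 ⟨_, hg⟩
    exact (h.1 _ h1).1
  · intro hP
    obtain ⟨t, ht, hr⟩ := h.2 hP
    have := Sem.seq hr (pad_run (B := B) (f := st ρ) rfl (C - t))
    rw [show t + (C - t) = C by omega] at this
    exact ⟨_, this⟩

end FO

end FOCP

theorem fo_reduces_to_fixed_counter_program {n : ℕ} (Φ : arithLang.Formula (Fin n)) :
    ∃ (k : ℕ) (C : CounterProgram k),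
      C.getLast? = some Instr.halt ∧
      ∃ p : Fin k → MvPolynomial (Fin (n + 1)) ℕ,
        ∀ (N : ℕ) (a : Fin n → Fin (N + 1)),
          SegModels N Φ a ↔
            ZeroTerminating C fun j =>
              MvPolynomial.eval (Fin.cons N fun i => ((a i : ℕ))) (p j) := by
  obtain ⟨m0, hm0⟩ := FOCP.spec_all (k := 0) Φ
  obtain ⟨m, hm, hnm⟩ : ∃ m, m0 ≤ m ∧ n ≤ m := ⟨max m0 n, le_max_left _ _, le_max_right _ _⟩
  obtain ⟨T, F, q, hT⟩ := hm0 m hm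
  let iv : Fin n → FOCP.W m := fun i => .var ⟨i.1, by omega⟩
  have hiv : Function.Injective iv := by
    intro i j h
    simp only [iv, FOCP.W.var.injEq, Fin.mk.injEq] at h
    exact Fin.ext h
  let p : FOCP.Prog (FOCP.W m) := .seq T (.star (.zt .u))
  let e := Fintype.equivFin (FOCP.K (FOCP.W m) n)
  let Q : MvPolynomial (Fin (n + 1)) ℕ := Polynomial.aeval (MvPolynomial.X 0) q
  let pol : FOCP.K (FOCP.W m) n → MvPolynomial (Fin (n + 1)) ℕ := fun x =>
    match x with
    | .cnt _ true => 0
    | .cnt _ false => MvPolynomial.X 0 + 1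
    | .c => Q
    | .d => 2 * (MvPolynomial.X 0 + 1) * Q
    | .inp i => MvPolynomial.X i.succ
  refine ⟨_, FOCP.comp e 1 (FOCP.full iv p) ++ [.halt], by simp, fun j => pol (e.symm j), ?_⟩
  intro N a
  have hQ : MvPolynomial.eval (Fin.cons N fun i => ((a i : ℕ))) Q = q.eval N := by
    simp only [Q, Polynomial.aeval_def, Polynomial.eval₂_eq_sum_range, map_sum, map_mul, map_pow,
      MvPolynomial.eval_X, Fin.cons_zero, Polynomial.eval_eq_sum_range]
    simp
  have hstart : (fun j => MvPolynomial.eval (Fin.cons N fun i => ((a i : ℕ))) (pol (e.symm j))) =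
      FOCP.start (N + 1) (q.eval N) (fun i => (a i : ℕ)) ∘ e.symm := by
    funext j
    simp only [Function.comp]
    generalize e.symm j = x
    rcases x with ⟨x, _ | _⟩ | _ | _ | i
    · simp [pol, FOCP.start]
    · simp [pol, FOCP.start]
    · simp [pol, FOCP.start, hQ]
    · simp [pol, FOCP.start, hQ]
    · simp [pol, FOCP.start]
  rw [hstart, FOCP.compile_correct]
  let ρ : Fin m → ℕ := fun w => if h : w.1 < n then a ⟨w.1, h⟩ else 0
  have hA : FOCP.Agree m N a (default : Fin 0 → Fin (N + 1)) ρ := by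
    refine ⟨fun w => ?_, fun i hi => ?_, fun j => j.elim0, fun w hw => ?_⟩
    · simp only [ρ]
      split_ifs
      · omega
      · omega
    · simp [ρ]
    · simp only [ρ]
      rw [dif_neg (by omega)]
  rw [FOCP.full_correct hiv (fun i => by omega) p (FOCP.st ρ) (fun i => by
      simp [iv, FOCP.st_var, ρ]) (fun x hx => by
      cases x with
      | var w =>
        rw [FOCP.st_var]
        simp only [ρ]
        split_ifs with h
        · exact absurd rfl (hx ⟨w.1, h⟩)
        · rfl
      | _ => rfl)]
  rw [FOCP.pad_iff (hT N a default ρ hA).1]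
  unfold SegModels Language.Formula.Realize
  exact iff_of_eq (congrArg _ (Subsingleton.elim _ _))
end

section
/- The counter program Copy[x,x'], defined as: loop { x' -= 1 }; zero-test(x'); loop { x -= 1; x' += 1; t += 1 }; zero-test(x); loop { t -= 1; x += 1 }; zero-test(t), satisfies: (1) Copy[x,x'] admits a valid run if and only if at the end of the run the values of x' and x both equal the initial value of x (val_end(x') = val_end(x) = val₁(x)); and (2) Copy[x,x'] is a component (every valid run performs exactly 3 zero tests). -/
/-!
STATEMENT 4: The counter program Copy[x,x'] defined as
`loop { x' -= 1 }; zero-test(x'); loop { x -= 1; x' += 1; t += 1 };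
zero-test(x); loop { t -= 1; x += 1 }; zero-test(t)` satisfies:
(1) Copy[x,x'] admits a valid run if and only if at the end of the run the
values of x' and x both equal the initial value of x
(val_end(x') = val_end(x) = val₁(x)); and
(2) Copy[x,x'] is a component (every valid run performs exactly 3 zero tests).

Property (1) is rendered as: from any initial configuration (satisfying the
ambient invariants of the construction: the hat-companion invariant, validity,
a sufficient budget on the testing counter u₁, and the auxiliary counter t
being 0) there exists a valid run, and every valid run ends with
val_end(x') = val_end(x) = val₁(x).
-/

/-- Structured counter programs over a set `V` of counters.  Every counter
`v ∈ V` has a companion (hat) counter `v̂`, and there are two distinguished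
testing counters `u₁`, `u₂`; this is built into the configurations below.
`zeroTest v` is the gadget
`loop { v += 1; v̂ -= 1; u₂ -= 1 }; loop { v -= 1; v̂ += 1; u₂ -= 1 }; u₁ -= 2`,
and `zeroTestHat v` is the same gadget applied to the companion counter `v̂`. -/
inductive CProg (V : Type) : Type
  | skip : CProg V
  | inc : V → ℕ → CProg V          -- v += c (accompanied by v̂ -= c)
  | dec : V → ℕ → CProg V          -- v -= c (accompanied by v̂ += c)
  | seq : CProg V → CProg V → CProg V
  | choice : CProg V → CProg V → CProg V   -- "C₁ or C₂"
  | loop : CProg V → CProg V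
  | zeroTest : V → CProg V
  | zeroTestHat : V → CProg V

/-- A configuration: the values of the counters of interest, of their hat
companions, and of the two testing counters `u₁` and `u₂`. -/
structure CState (V : Type) where
  val : V → ℕ
  hat : V → ℕ
  u1 : ℕ
  u2 : ℕ

/-- Big-step semantics: `Exec p s n t` means that program `p` has a complete
run from configuration `s` to configuration `t` (reaching the final `halt`)
performing exactly `n` zero-test instructions.  Every `v += c` is accompanied
by `v̂ -= c` and vice versa; decrements block if a counter would go negative.
The `zeroTest v` case captures exactly the runs of the gadget
`loop { v += 1; v̂ -= 1; u₂ -= 1 }; loop { v -= 1; v̂ += 1; u₂ -= 1 }; u₁ -= 2`,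
where the first loop is executed `m₁` times and the second one `m₂` times. -/
inductive Exec {V : Type} [DecidableEq V] : CProg V → CState V → ℕ → CState V → Prop
  | skip (s : CState V) : Exec .skip s 0 s
  | inc (v : V) (c : ℕ) (s : CState V) (h : c ≤ s.hat v) :
      Exec (.inc v c) s 0
        ⟨Function.update s.val v (s.val v + c),
         Function.update s.hat v (s.hat v - c), s.u1, s.u2⟩
  | dec (v : V) (c : ℕ) (s : CState V) (h : c ≤ s.val v) :
      Exec (.dec v c) s 0
        ⟨Function.update s.val v (s.val v - c),
         Function.update s.hat v (s.hat v + c), s.u1, s.u2⟩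
  | seq {p q : CProg V} {s t u : CState V} {n m : ℕ}
      (h1 : Exec p s n t) (h2 : Exec q t m u) : Exec (.seq p q) s (n + m) u
  | choiceL {p : CProg V} (q : CProg V) {s t : CState V} {n : ℕ}
      (h : Exec p s n t) : Exec (.choice p q) s n t
  | choiceR (p : CProg V) {q : CProg V} {s t : CState V} {n : ℕ}
      (h : Exec q s n t) : Exec (.choice p q) s n t
  | loopStop (p : CProg V) (s : CState V) : Exec (.loop p) s 0 s
  | loopStep {p : CProg V} {s t u : CState V} {n m : ℕ}
      (h1 : Exec p s n t) (h2 : Exec (.loop p) t m u) : Exec (.loop p) s (n + m) u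
  | zeroTest (v : V) (s : CState V) (m₁ m₂ : ℕ)
      (h1 : m₁ ≤ s.hat v) (h2 : m₂ ≤ s.val v + m₁) (h3 : m₁ + m₂ ≤ s.u2) (h4 : 2 ≤ s.u1) :
      Exec (.zeroTest v) s 1
        ⟨Function.update s.val v (s.val v + m₁ - m₂),
         Function.update s.hat v (s.hat v - m₁ + m₂),
         s.u1 - 2, s.u2 - (m₁ + m₂)⟩
  | zeroTestHat (v : V) (s : CState V) (m₁ m₂ : ℕ)
      (h1 : m₁ ≤ s.val v) (h2 : m₂ ≤ s.hat v + m₁) (h3 : m₁ + m₂ ≤ s.u2) (h4 : 2 ≤ s.u1) :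
      Exec (.zeroTestHat v) s 1
        ⟨Function.update s.val v (s.val v - m₁ + m₂),
         Function.update s.hat v (s.hat v + m₁ - m₂),
         s.u1 - 2, s.u2 - (m₁ + m₂)⟩

/-- A configuration is valid if `u₂ = u₁ · N`. -/
def ValidCfg {V : Type} (N : ℕ) (s : CState V) : Prop := s.u2 = s.u1 * N

/-- The hat-companion invariant: `v + v̂ = N` for every counter `v`. -/
def HatInv {V : Type} (N : ℕ) (s : CState V) : Prop := ∀ v, s.val v + s.hat v = N

/-- `C` admits a valid run from `s`: a run starting in a valid configuration,
reaching the final `halt` instruction, and ending in a valid configuration. -/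
def AdmitsValidRun {V : Type} [DecidableEq V] (N : ℕ) (C : CProg V) (s : CState V) : Prop :=
  ValidCfg N s ∧ ∃ (n : ℕ) (t : CState V), Exec C s n t ∧ ValidCfg N t

/-- `C` is a component: there is a polynomial bounding, in terms of the bound
`N`, the number of zero tests performed by any valid run (the testing counters
`u₁`, `u₂` are updated only by zero-test instructions, by the very construction
of the syntax). -/
def IsComponent {V : Type} [DecidableEq V] (C : CProg V) : Prop :=
  ∃ p : Polynomial ℕ, ∀ (N : ℕ) (s t : CState V) (n : ℕ),
    HatInv N s → ValidCfg N s → Exec C s n t → ValidCfg N t → n ≤ Polynomial.eval N p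

/-- The program `Copy[x,x']` (with auxiliary counter `t`):
`loop { x' -= 1 }; zero-test(x'); loop { x -= 1; x' += 1; t += 1 };
zero-test(x); loop { t -= 1; x += 1 }; zero-test(t)`. -/
def copyProg {V : Type} (x x' t : V) : CProg V :=
  .seq (.loop (.dec x' 1))
  (.seq (.zeroTest x')
  (.seq (.loop (.seq (.dec x 1) (.seq (.inc x' 1) (.inc t 1))))
  (.seq (.zeroTest x)
  (.seq (.loop (.seq (.dec t 1) (.inc x 1)))
        (.zeroTest t)))))

theorem exec_loop_rel {V : Type} [DecidableEq V] {p : CProg V}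
    (R : CState V → CState V → Prop) (hrefl : ∀ s, R s s)
    (htrans : ∀ a b c, R a b → R b c → R a c)
    (hbody : ∀ s n t, Exec p s n t → n = 0 ∧ R s t)
    {s t : CState V} {n : ℕ} (h : Exec (.loop p) s n t) : n = 0 ∧ R s t := by
  generalize hq : CProg.loop p = q at h
  induction h with
  | loopStop p s => exact ⟨rfl, hrefl _⟩
  | loopStep h1 h2 ih1 ih2 =>
    cases hq
    obtain ⟨a, b⟩ := hbody _ _ _ h1
    obtain ⟨c, d⟩ := ih2 rfl
    exact ⟨by omega, htrans _ _ _ b d⟩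
  | _ => cases hq

theorem exec_zeroTest {V : Type} [DecidableEq V] {v : V} {s t : CState V} {n : ℕ} (N : ℕ)
    (h : Exec (.zeroTest v) s n t) (hs : HatInv N s) : n = 1 ∧ HatInv N t ∧ t.u1 + 2 = s.u1 ∧
      (∃ k, k ≤ 2 * N ∧ t.u2 + k = s.u2 ∧ (k = 2 * N → s.val v = 0 ∧ t.val v = 0)) ∧
      ∀ w, w ≠ v → t.val w = s.val w := by
  cases h with
  | zeroTest v s m₁ m₂ h1 h2 h3 h4 =>
    have hv := hs v
    refine ⟨rfl, ?_, by simp only; omega, ⟨m₁ + m₂, by omega, by simp only; omega, ?_⟩, ?_⟩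
    · intro w
      have := hs w
      by_cases hw : w = v
      · subst hw; simp only [Function.update_self]; omega
      · simpa [Function.update_of_ne hw] using this
    · intro hk; simp only [Function.update_self]; omega
    · intro w hw; simp [Function.update_of_ne hw]

theorem zeroTest_exists {V : Type} [DecidableEq V] {v : V} {s : CState V} (N : ℕ)
    (hs : HatInv N s) (h0 : s.val v = 0) (h1 : 2 ≤ s.u1) (h2 : 2 * N ≤ s.u2) :
    Exec (.zeroTest v) s 1 ⟨s.val, s.hat, s.u1 - 2, s.u2 - 2 * N⟩ := by
  have hv := hs v
  have := Exec.zeroTest v s N N (by omega) (by omega) (by omega) h1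
  convert this using 2
  · rw [eq_comm, Function.update_eq_self_iff]; omega
  · rw [eq_comm, Function.update_eq_self_iff]; omega
  · omega

theorem inc_inv {V : Type} [DecidableEq V] {v : V} {c : ℕ} {s t : CState V} {n : ℕ}
    (h : Exec (.inc v c) s n t) : n = 0 ∧ (∀ N, HatInv N s → HatInv N t) ∧ t.u1 = s.u1 ∧
      t.u2 = s.u2 ∧ t.val v = s.val v + c ∧ ∀ w, w ≠ v → t.val w = s.val w := by
  cases h with
  | inc v c s h =>
    refine ⟨rfl, ?_, rfl, rfl, by simp, ?_⟩
    · intro N hs w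
      have := hs w
      by_cases hw : w = v
      · subst hw; simp only [Function.update_self]; omega
      · simpa [Function.update_of_ne hw] using this
    · intro w hw; simp [Function.update_of_ne hw]

theorem dec_inv {V : Type} [DecidableEq V] {v : V} {c : ℕ} {s t : CState V} {n : ℕ}
    (h : Exec (.dec v c) s n t) : n = 0 ∧ (∀ N, HatInv N s → HatInv N t) ∧ t.u1 = s.u1 ∧
      t.u2 = s.u2 ∧ t.val v + c = s.val v ∧ ∀ w, w ≠ v → t.val w = s.val w := by
  cases h with
  | dec v c s h =>
    refine ⟨rfl, ?_, rfl, rfl, by simp only [Function.update_self]; omega, ?_⟩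
    · intro N hs w
      have := hs w
      by_cases hw : w = v
      · subst hw; simp only [Function.update_self]; omega
      · simpa [Function.update_of_ne hw] using this
    · intro w hw; simp [Function.update_of_ne hw]

theorem inc_exists {V : Type} [DecidableEq V] {v : V} {s : CState V} (N : ℕ) (hs : HatInv N s)
    (h : s.val v + 1 ≤ N) : ∃ t, Exec (.inc v 1) s 0 t :=
  ⟨_, Exec.inc v 1 s (by have := hs v; omega)⟩

theorem dec_exists {V : Type} [DecidableEq V] {v : V} {s : CState V}
    (h : 1 ≤ s.val v) : ∃ t, Exec (.dec v 1) s 0 t :=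
  ⟨_, Exec.dec v 1 s h⟩

theorem loop1_inv {V : Type} [DecidableEq V] {x' : V} {s u : CState V} {n : ℕ}
    (h : Exec (.loop (.dec x' 1)) s n u) : n = 0 ∧ (∀ N, HatInv N s → HatInv N u) ∧
      u.u1 = s.u1 ∧ u.u2 = s.u2 ∧ ∀ w, w ≠ x' → u.val w = s.val w := by
  refine exec_loop_rel (fun s u => (∀ N, HatInv N s → HatInv N u) ∧
      u.u1 = s.u1 ∧ u.u2 = s.u2 ∧ ∀ w, w ≠ x' → u.val w = s.val w) ?_ ?_ ?_ h
  · intro s; simp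
  · rintro a b c ⟨h1, h2, h3, h4⟩ ⟨k1, k2, k3, k4⟩
    exact ⟨fun N h => k1 N (h1 N h), k2.trans h2, k3.trans h3,
      fun w hw => (k4 w hw).trans (h4 w hw)⟩
  · intro s n t h
    obtain ⟨a, b, c, d, _, f⟩ := dec_inv h
    exact ⟨a, b, c, d, f⟩

theorem loop2_inv {V : Type} [DecidableEq V] {x x' t : V} (h1 : x ≠ x') (h2 : x ≠ t)
    (h3 : x' ≠ t) {s u : CState V} {n : ℕ}
    (h : Exec (.loop (.seq (.dec x 1) (.seq (.inc x' 1) (.inc t 1)))) s n u) :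
    n = 0 ∧ (∀ N, HatInv N s → HatInv N u) ∧ u.u1 = s.u1 ∧ u.u2 = s.u2 ∧
      u.val x + u.val x' = s.val x + s.val x' ∧ u.val x + u.val t = s.val x + s.val t := by
  refine exec_loop_rel (fun s u => (∀ N, HatInv N s → HatInv N u) ∧ u.u1 = s.u1 ∧
      u.u2 = s.u2 ∧ u.val x + u.val x' = s.val x + s.val x' ∧
      u.val x + u.val t = s.val x + s.val t) ?_ ?_ ?_ h
  · intro s; simp
  · rintro a b c ⟨h1, h2, h3, h4, h5⟩ ⟨k1, k2, k3, k4, k5⟩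
    exact ⟨fun N h => k1 N (h1 N h), k2.trans h2, k3.trans h3, k4.trans h4, k5.trans h5⟩
  · intro s n u h
    cases h with
    | seq ha h =>
    cases h with
    | seq hb hc =>
    obtain ⟨a, b, c, d, e, f⟩ := dec_inv ha
    obtain ⟨a', b', c', d', e', f'⟩ := inc_inv hb
    obtain ⟨a'', b'', c'', d'', e'', f''⟩ := inc_inv hc
    have := f x' h1.symm
    have := f t h2.symm
    have := f' x h1
    have := f' t h3.symm
    have := f'' x h2
    have := f'' x' h3
    exact ⟨by omega, fun N h => b'' N (b' N (b N h)), by omega, by omega, by omega, by omega⟩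

theorem loop3_inv {V : Type} [DecidableEq V] {x t : V} (h2 : x ≠ t) {s u : CState V} {n : ℕ}
    (h : Exec (.loop (.seq (.dec t 1) (.inc x 1))) s n u) :
    n = 0 ∧ (∀ N, HatInv N s → HatInv N u) ∧ u.u1 = s.u1 ∧ u.u2 = s.u2 ∧
      u.val x + u.val t = s.val x + s.val t ∧ ∀ w, w ≠ x → w ≠ t → u.val w = s.val w := by
  refine exec_loop_rel (fun s u => (∀ N, HatInv N s → HatInv N u) ∧ u.u1 = s.u1 ∧
      u.u2 = s.u2 ∧ u.val x + u.val t = s.val x + s.val t ∧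
      ∀ w, w ≠ x → w ≠ t → u.val w = s.val w) ?_ ?_ ?_ h
  · intro s; simp
  · rintro a b c ⟨h1, h2, h3, h4, h5⟩ ⟨k1, k2, k3, k4, k5⟩
    exact ⟨fun N h => k1 N (h1 N h), k2.trans h2, k3.trans h3, k4.trans h4,
      fun w hw hw' => (k5 w hw hw').trans (h5 w hw hw')⟩
  · intro s n u h
    cases h with
    | seq ha hb =>
    obtain ⟨a, b, c, d, e, f⟩ := dec_inv ha
    obtain ⟨a', b', c', d', e', f'⟩ := inc_inv hb
    have := f x h2
    have := f' t h2.symm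
    exact ⟨by omega, fun N h => b' N (b N h), by omega, by omega, by omega,
      fun w hw hw' => (f' w hw).trans (f w hw')⟩

theorem loop1_exists {V : Type} [DecidableEq V] {x' : V} (k : ℕ) : ∀ s : CState V,
    s.val x' = k → ∃ u, Exec (.loop (.dec x' 1)) s 0 u ∧ u.val x' = 0 := by
  induction k with
  | zero => intro s h; exact ⟨s, .loopStop _ _, h⟩
  | succ k ih =>
    intro s h
    obtain ⟨a, ha⟩ := dec_exists (v := x') (s := s) (by omega)
    obtain ⟨_, _, _, _, e, _⟩ := dec_inv ha
    obtain ⟨u, hu, hu'⟩ := ih a (by omega)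
    exact ⟨u, .loopStep ha hu, hu'⟩

theorem loop2_exists {V : Type} [DecidableEq V] {x x' t : V} (h1 : x ≠ x') (h2 : x ≠ t)
    (h3 : x' ≠ t) (N k : ℕ) : ∀ s : CState V, HatInv N s → s.val x = k →
    s.val x + s.val x' ≤ N → s.val x + s.val t ≤ N →
    ∃ u, Exec (.loop (.seq (.dec x 1) (.seq (.inc x' 1) (.inc t 1)))) s 0 u ∧ u.val x = 0 := by
  induction k with
  | zero => intro s _ h _ _; exact ⟨s, .loopStop _ _, h⟩
  | succ k ih =>
    intro s hs h hx ht
    obtain ⟨p, ha⟩ := dec_exists (v := x) (s := s) (by omega)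
    obtain ⟨a, b, c, d, e, f⟩ := dec_inv ha
    have := f x' h1.symm
    have := f t h2.symm
    obtain ⟨q, hb⟩ := inc_exists (v := x') (s := p) N (b N hs) (by omega)
    obtain ⟨a', b', c', d', e', f'⟩ := inc_inv hb
    have := f' x h1
    have := f' t h3.symm
    obtain ⟨r, hc⟩ := inc_exists (v := t) (s := q) N (b' N (b N hs)) (by omega)
    obtain ⟨a'', b'', c'', d'', e'', f''⟩ := inc_inv hc
    have := f'' x h2
    have := f'' x' h3
    obtain ⟨u, hu, hu'⟩ := ih r (b'' N (b' N (b N hs))) (by omega) (by omega) (by omega)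
    exact ⟨u, .loopStep (.seq ha (.seq hb hc)) hu, hu'⟩

theorem loop3_exists {V : Type} [DecidableEq V] {x t : V} (h2 : x ≠ t)
    (N k : ℕ) : ∀ s : CState V, HatInv N s → s.val t = k → s.val x + s.val t ≤ N →
    ∃ u, Exec (.loop (.seq (.dec t 1) (.inc x 1))) s 0 u ∧ u.val t = 0 := by
  induction k with
  | zero => intro s _ h _; exact ⟨s, .loopStop _ _, h⟩
  | succ k ih =>
    intro s hs h ht
    obtain ⟨p, ha⟩ := dec_exists (v := t) (s := s) (by omega)
    obtain ⟨a, b, c, d, e, f⟩ := dec_inv ha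
    have := f x h2
    obtain ⟨q, hb⟩ := inc_exists (v := x) (s := p) N (b N hs) (by omega)
    obtain ⟨a', b', c', d', e', f'⟩ := inc_inv hb
    have := f' t h2.symm
    obtain ⟨u, hu, hu'⟩ := ih q (b' N (b N hs)) (by omega) (by omega)
    exact ⟨u, .loopStep (.seq ha hb) hu, hu'⟩

theorem copy_inv {V : Type} [DecidableEq V] {x x' t : V} (h1 : x ≠ x') (h2 : x ≠ t)
    (h3 : x' ≠ t) (N : ℕ) {s u : CState V} {n : ℕ} (hs : HatInv N s) (hv : ValidCfg N s)
    (h : Exec (copyProg x x' t) s n u) (hu : ValidCfg N u) :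
    n = 3 ∧ (s.val t = 0 → u.val x' = s.val x ∧ u.val x = s.val x) := by
  unfold copyProg at h
  cases h with
  | seq e1 h =>
  cases h with
  | seq e2 h =>
  cases h with
  | seq e3 h =>
  cases h with
  | seq e4 h =>
  cases h with
  | seq e5 e6 =>
  obtain ⟨n1, i1, a1, b1, f1⟩ := loop1_inv e1
  replace i1 := i1 N hs
  obtain ⟨n2, i2, a2, ⟨k2, l2, b2, z2⟩, f2⟩ := exec_zeroTest N e2 i1
  obtain ⟨n3, i3, a3, b3, c3, d3⟩ := loop2_inv h1 h2 h3 e3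
  replace i3 := i3 N i2
  obtain ⟨n4, i4, a4, ⟨k4, l4, b4, z4⟩, f4⟩ := exec_zeroTest N e4 i3
  obtain ⟨n5, i5, a5, b5, c5, f5⟩ := loop3_inv h2 e5
  replace i5 := i5 N i4
  obtain ⟨n6, i6, a6, ⟨k6, l6, b6, z6⟩, f6⟩ := exec_zeroTest N e6 i5
  refine ⟨by omega, fun ht => ?_⟩
  unfold ValidCfg at hv hu
  have hu1 : s.u1 = u.u1 + 6 := by omega
  rw [hu1, add_mul] at hv
  have := z2 (by omega)
  have := z4 (by omega)
  have := z6 (by omega)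
  have := f1 x h1
  have := f1 t h3.symm
  have := f2 x h1
  have := f2 t h3.symm
  have := f4 x' h1.symm
  have := f4 t h2.symm
  have := f5 x' h1.symm h3
  have := f6 x h2
  have := f6 x' h3
  omega

theorem copy_exists {V : Type} [DecidableEq V] {x x' t : V} (h1 : x ≠ x') (h2 : x ≠ t)
    (h3 : x' ≠ t) (N : ℕ) {s : CState V} (hs : HatInv N s) (hv : ValidCfg N s)
    (hb : 6 ≤ s.u1) (ht : s.val t = 0) :
    ∃ n u, Exec (copyProg x x' t) s n u ∧ ValidCfg N u := by
  unfold ValidCfg at *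
  obtain ⟨m, hm⟩ := Nat.exists_eq_add_of_le hb
  rw [hm, add_mul] at hv
  obtain ⟨p1, e1, g1⟩ := loop1_exists (x' := x') _ s rfl
  obtain ⟨-, i1, a1, b1, f1⟩ := loop1_inv e1
  replace i1 := i1 N hs
  have e2 := zeroTest_exists N i1 g1 (by omega) (by omega)
  set p2 : CState V := ⟨p1.val, p1.hat, p1.u1 - 2, p1.u2 - 2 * N⟩ with hp2
  have i2 : HatInv N p2 := i1
  have := f1 x h1
  have := f1 t h3.symm
  have v2 : p2.val = p1.val := rfl
  have a2 : p2.u1 = p1.u1 - 2 := rfl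
  have b2 : p2.u2 = p1.u2 - 2 * N := rfl
  have hx := hs x
  obtain ⟨p3, e3, g3⟩ := loop2_exists h1 h2 h3 N _ p2 i2 rfl
    (by rw [v2]; omega) (by rw [v2]; omega)
  obtain ⟨-, i3, a3, b3, c3, d3⟩ := loop2_inv h1 h2 h3 e3
  replace i3 := i3 N i2
  have e4 := zeroTest_exists N i3 g3 (by omega) (by omega)
  set p4 : CState V := ⟨p3.val, p3.hat, p3.u1 - 2, p3.u2 - 2 * N⟩ with hp4
  have i4 : HatInv N p4 := i3
  have v4 : p4.val = p3.val := rfl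
  have a4 : p4.u1 = p3.u1 - 2 := rfl
  have b4 : p4.u2 = p3.u2 - 2 * N := rfl
  rw [v2] at d3
  obtain ⟨p5, e5, g5⟩ := loop3_exists h2 N _ p4 i4 rfl (by rw [v4]; omega)
  obtain ⟨-, i5, a5, b5, c5, f5⟩ := loop3_inv h2 e5
  replace i5 := i5 N i4
  have e6 := zeroTest_exists N i5 g5 (by omega) (by omega)
  refine ⟨_, _, .seq e1 (.seq e2 (.seq e3 (.seq e4 (.seq e5 e6)))), ?_⟩
  have : p5.u1 - 2 = m := by omega
  simp only [this]
  omega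

theorem copy_spec {V : Type} [DecidableEq V] (x x' t : V)
    (hdist : Function.Injective ![x, x', t])
    (N : ℕ) (s : CState V)
    (hinv : HatInv N s) (hvalid : ValidCfg N s)
    (hbudget : 6 ≤ s.u1) (ht : s.val t = 0) :
    -- (1) Copy[x,x'] admits a valid run iff val_end(x') = val_end(x) = val₁(x)
    ((∃ (n : ℕ) (u : CState V), Exec (copyProg x x' t) s n u ∧ ValidCfg N u ∧
        u.val x' = s.val x ∧ u.val x = s.val x) ∧
      (∀ (n : ℕ) (u : CState V), Exec (copyProg x x' t) s n u → ValidCfg N u →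
        u.val x' = s.val x ∧ u.val x = s.val x)) ∧
    -- (2) Copy[x,x'] is a component; every valid run performs exactly 3 zero tests
    (IsComponent (copyProg x x' t) ∧
      ∀ (n : ℕ) (u : CState V), Exec (copyProg x x' t) s n u → ValidCfg N u →
        n = 3) := by
  have h1 : x ≠ x' := fun h => by
    have := @hdist 0 1 (by simpa using h)
    simp at this
  have h2 : x ≠ t := fun h => by
    have := @hdist 0 2 (by simpa using h)
    simp at this
  have h3 : x' ≠ t := fun h => by
    have := @hdist 1 2 (by simpa using h)
    simp at this
  refine ⟨⟨?_, fun n u h hu => (copy_inv h1 h2 h3 N hinv hvalid h hu).2 ht⟩, ⟨3, ?_⟩,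
    fun n u h hu => (copy_inv h1 h2 h3 N hinv hvalid h hu).1⟩
  · obtain ⟨n, u, h, hu⟩ := copy_exists h1 h2 h3 N hinv hvalid hbudget ht
    exact ⟨n, u, h, hu, (copy_inv h1 h2 h3 N hinv hvalid h hu).2 ht⟩
  · intro M a b n ha hva h hb
    have := (copy_inv h1 h2 h3 M ha hva h hb).1
    simp [this]
end
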